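/- For every p ∈ (1,∞), the parabolic algebra A_par^p equals the Fourier binest algebra A_FB^p. In particular, A_par^p is reflexive: it equals the algebra of all bounded operators on L^p(ℝ) leaving invariant every closed subspace that is invariant under A_par^p. -/

import Mathlib

open MeasureTheory Complex Filter Topology
open scoped ENNReal NNReal

noncomputable section

/-- `L^p(ℝ)` with complex values. -/
abbrev LpR (p : ℝ≥0∞) := MeasureTheory.Lp ℂ p (volume : Measure ℝ)

/-- The Bochner space `L^p(ℝ; L^q(ℝ))`. -/
abbrev LpLq (p q : ℝ≥0∞) [Fact (1 ≤ q)] := MeasureTheory.Lp (LpR q) p (volume : Measure ℝ)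

/-- `T` is the operator of multiplication by `φ`. -/
def IsMulOp (p : ℝ≥0∞) [Fact (1 ≤ p)] (φ : ℝ → ℂ) (T : LpR p →L[ℂ] LpR p) : Prop :=
  ∀ f : LpR p, (T f : ℝ → ℂ) =ᵐ[volume] fun x => φ x * (f : ℝ → ℂ) x

/-- `T` is the operator of translation by `μ`: `(T f)(x) = f (x - μ)`. -/
def IsTransOp (p : ℝ≥0∞) [Fact (1 ≤ p)] (μ : ℝ) (T : LpR p →L[ℂ] LpR p) : Prop :=
  ∀ f : LpR p, (T f : ℝ → ℂ) =ᵐ[volume] fun x => (f : ℝ → ℂ) (x - μ)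

/-- A set of operators is closed in the strong operator topology (the topology of
pointwise norm convergence) if it contains every operator which is an SOT-limit point. -/
def IsSOTClosed (p : ℝ≥0∞) [Fact (1 ≤ p)] (S : Set (LpR p →L[ℂ] LpR p)) : Prop :=
  ∀ T : LpR p →L[ℂ] LpR p,
    (⇑T ∈ closure ((fun A : LpR p →L[ℂ] LpR p => (A : LpR p → LpR p)) '' S)) → T ∈ S

/-- The generators of the parabolic algebra: multiplications `M_λ`, `λ ≥ 0`, and
translations `D_μ`, `μ ≥ 0`. -/
def parabolicGens (p : ℝ≥0∞) [Fact (1 ≤ p)] : Set (LpR p →L[ℂ] LpR p) :=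
  {T | ∃ l : ℝ, 0 ≤ l ∧ IsMulOp p (fun x => Complex.exp (Complex.I * l * x)) T} ∪
  {T | ∃ m : ℝ, 0 ≤ m ∧ IsTransOp p m T}

/-- The parabolic algebra: the smallest SOT-closed subalgebra of `B(L^p(ℝ))` containing
the multiplication semigroup and the translation semigroup. -/
def parabolicAlgebra (p : ℝ≥0∞) [Fact (1 ≤ p)] : Set (LpR p →L[ℂ] LpR p) :=
  ⋂₀ {S | parabolicGens p ⊆ S ∧ IsSOTClosed p S ∧
      ∃ A : Subalgebra ℂ (LpR p →L[ℂ] LpR p), (A : Set (LpR p →L[ℂ] LpR p)) = S}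

/-- The Hardy space `H^p(ℝ)`, as a subset of `L^p(ℝ)`. -/
def hardy (p : ℝ≥0∞) [Fact (1 ≤ p)] : Set (LpR p) :=
  {f | ∀ u : ℂ, 0 < u.im → ∫ x : ℝ, (f : ℝ → ℂ) x / ((x : ℂ) + u) = 0}

/-- `L^p[t,∞)`, the subspace of functions vanishing a.e. on `(-∞, t)`. -/
def LpHalfLine (p : ℝ≥0∞) [Fact (1 ≤ p)] (t : ℝ) : Set (LpR p) :=
  {f | ∀ᵐ x : ℝ, x < t → (f : ℝ → ℂ) x = 0}

/-- The image of the Hardy space under multiplication by the function `φ`. -/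
def mulHardy (p : ℝ≥0∞) [Fact (1 ≤ p)] (φ : ℝ → ℂ) : Set (LpR p) :=
  {g | ∃ f ∈ hardy p, (g : ℝ → ℂ) =ᵐ[volume] fun x => φ x * (f : ℝ → ℂ) x}

/-- The Fourier binest algebra: operators leaving invariant each `L^p[t,∞)` and each
`e^{iλx}H^p(ℝ)`. -/
def fourierBinest (p : ℝ≥0∞) [Fact (1 ≤ p)] : Set (LpR p →L[ℂ] LpR p) :=
  {T | (∀ t : ℝ, ∀ f ∈ LpHalfLine p t, T f ∈ LpHalfLine p t) ∧
       (∀ l : ℝ, ∀ f ∈ mulHardy p (fun x => Complex.exp (Complex.I * l * x)),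
          T f ∈ mulHardy p (fun x => Complex.exp (Complex.I * l * x)))}

/-- `T` is the `(p,q)`-integral operator with kernel `k`. -/
def IsIntOp (p q : ℝ≥0∞) [Fact (1 ≤ p)] [Fact (1 ≤ q)] (k : LpLq p q)
    (T : LpR p →L[ℂ] LpR p) : Prop :=
  ∀ f : LpR p, (T f : ℝ → ℂ) =ᵐ[volume]
    fun x => ∫ y : ℝ, ((k : ℝ → LpR q) x : ℝ → ℂ) y * (f : ℝ → ℂ) y

/-- `G^p`, the set of `(p,q)`-integral operators on `L^p(ℝ)`. -/
def Gp (p q : ℝ≥0∞) [Fact (1 ≤ p)] [Fact (1 ≤ q)] : Set (LpR p →L[ℂ] LpR p) :=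
  {T | ∃ k : LpLq p q, IsIntOp p q k T}


open scoped BoundedContinuousFunction

section Operators

theorem memLp_bcf_mul {p : ℝ≥0∞} (φ : ℝ →ᵇ ℂ) (f : LpR p) :
    MemLp (fun x => φ x * f x) p volume :=
  (Lp.memLp f).of_le_mul (c := ‖φ‖)
    (φ.continuous.aestronglyMeasurable.mul (Lp.aestronglyMeasurable f))
    (Eventually.of_forall fun x => by
      rw [norm_mul]; gcongr; exact φ.norm_coe_le_norm x)

variable {p : ℝ≥0∞} [Fact (1 ≤ p)]

/-- Multiplication by a bounded continuous function, as an operator on `L^p(ℝ)`. -/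
def mulOp (φ : ℝ →ᵇ ℂ) : LpR p →L[ℂ] LpR p :=
  LinearMap.mkContinuous
    { toFun := fun f => (memLp_bcf_mul φ f).toLp _
      map_add' := fun f g => by
        rw [← MemLp.toLp_add]
        refine MemLp.toLp_congr _ _ ?_
        filter_upwards [Lp.coeFn_add f g] with x hx
        rw [hx, Pi.add_apply, Pi.add_apply, mul_add]
      map_smul' := fun c f => by
        rw [RingHom.id_apply, ← MemLp.toLp_const_smul]
        refine MemLp.toLp_congr _ _ ?_
        filter_upwards [Lp.coeFn_smul c f] with x hx
        rw [hx, Pi.smul_apply, Pi.smul_apply, smul_eq_mul, smul_eq_mul, mul_left_comm] }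
    ‖φ‖ (fun f => by
      refine Lp.norm_le_mul_norm_of_ae_le_mul ?_
      filter_upwards [(memLp_bcf_mul φ f).coeFn_toLp] with x hx
      simp only [LinearMap.coe_mk, AddHom.coe_mk]
      rw [hx, norm_mul]; gcongr; exact φ.norm_coe_le_norm x)

theorem coeFn_mulOp (φ : ℝ →ᵇ ℂ) (f : LpR p) :
    (mulOp φ f : ℝ → ℂ) =ᵐ[volume] fun x => φ x * f x :=
  (memLp_bcf_mul φ f).coeFn_toLp

theorem norm_mulOp_le (φ : ℝ →ᵇ ℂ) : ‖(mulOp φ : LpR p →L[ℂ] LpR p)‖ ≤ ‖φ‖ :=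
  LinearMap.mkContinuous_norm_le _ (norm_nonneg _) _

theorem eq_mulOp_iff {φ : ℝ →ᵇ ℂ} {T : LpR p →L[ℂ] LpR p} :
    IsMulOp p φ T ↔ T = mulOp φ := by
  refine ⟨fun h => ?_, fun h f => h ▸ coeFn_mulOp φ f⟩
  ext1 f
  exact Lp.ext ((h f).trans (coeFn_mulOp φ f).symm)

theorem mulOp_comp (φ ψ : ℝ →ᵇ ℂ) (f : LpR p) : mulOp φ (mulOp ψ f) = mulOp (φ * ψ) f := by
  refine Lp.ext ?_
  filter_upwards [coeFn_mulOp φ (mulOp ψ f), coeFn_mulOp ψ f, coeFn_mulOp (φ * ψ) f]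
    with x h1 h2 h3
  rw [h1, h2, h3, BoundedContinuousFunction.mul_apply, mul_assoc]

theorem mulOp_one (f : LpR p) : mulOp 1 f = f := by
  refine Lp.ext ?_
  filter_upwards [coeFn_mulOp 1 f] with x h1
  simp [h1]

theorem tendsto_mulOp (hp' : p ≠ ⊤) {ι : Type*} {l : Filter ι} [l.IsCountablyGenerated]
    {φ : ι → ℝ →ᵇ ℂ} {ψ : ℝ →ᵇ ℂ} {C : ℝ} (hC : ∀ i, ‖φ i‖ ≤ C)
    (h : ∀ x, Tendsto (fun i => φ i x) l (𝓝 (ψ x))) (f : LpR p) :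
    Tendsto (fun i => mulOp (φ i) f) l (𝓝 (mulOp ψ f)) := by
  rw [Lp.tendsto_Lp_iff_tendsto_eLpNorm']
  have hp0 : p ≠ 0 := (zero_lt_one.trans_le (Fact.out : 1 ≤ p)).ne'
  have hpr : 0 < p.toReal := ENNReal.toReal_pos hp0 hp'
  have key : Tendsto (fun i => ∫⁻ x, ‖(φ i x - ψ x) * f x‖ₑ ^ p.toReal) l (𝓝 0) := by
    have : (0 : ℝ≥0∞) = ∫⁻ _ : ℝ, 0 := by simp
    rw [this]
    refine tendsto_lintegral_filter_of_dominated_convergence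
      (fun x => ((ENNReal.ofReal (C + ‖ψ‖)) * ‖f x‖ₑ) ^ p.toReal) ?_ ?_ ?_ ?_
    · refine Eventually.of_forall fun i => ?_
      exact ((((φ i).continuous.sub ψ.continuous).stronglyMeasurable.mul
        (Lp.stronglyMeasurable f)).enorm).pow_const _
    · refine Eventually.of_forall fun i => Eventually.of_forall fun x => ?_
      gcongr
      rw [enorm_mul]
      gcongr
      rw [← ofReal_norm]
      refine ENNReal.ofReal_le_ofReal ((norm_sub_le _ _).trans ?_)
      exact add_le_add (((φ i).norm_coe_le_norm x).trans (hC i)) (ψ.norm_coe_le_norm x)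
    · simp_rw [ENNReal.mul_rpow_of_nonneg _ _ hpr.le]
      rw [lintegral_const_mul' _ _ (by finiteness)]
      refine ENNReal.mul_ne_top (by finiteness) ?_
      exact (lintegral_rpow_enorm_lt_top_of_eLpNorm_lt_top hp0 hp'
        (Lp.eLpNorm_lt_top f)).ne
    · refine Eventually.of_forall fun x => ?_
      have h1 : Tendsto (fun i => (φ i x - ψ x) * f x) l (𝓝 0) := by
        simpa using ((h x).sub_const (ψ x)).mul_const (f x)
      have h2 := (h1.enorm).ennrpow_const p.toReal
      simpa [hpr] using h2
  have key2 := key.ennrpow_const (1 / p.toReal)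
  rw [ENNReal.zero_rpow_of_pos (by positivity)] at key2
  refine key2.congr fun i => ?_
  rw [← eLpNorm_eq_lintegral_rpow_enorm_toReal hp0 hp']
  refine eLpNorm_congr_ae ?_
  filter_upwards [coeFn_mulOp (φ i) f, coeFn_mulOp ψ f] with x h1 h2
  rw [Pi.sub_apply, h1, h2, sub_mul]

/-- Translation by `s`, as an operator on `L^p(ℝ)`. -/
def transOp (s : ℝ) : LpR p →L[ℂ] LpR p :=
  (Lp.compMeasurePreservingₗᵢ ℂ (fun x : ℝ => x - s)
    (measurePreserving_sub_right volume s)).toContinuousLinearMap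

theorem coeFn_transOp (s : ℝ) (f : LpR p) :
    (transOp s f : ℝ → ℂ) =ᵐ[volume] fun x => f (x - s) :=
  Lp.coeFn_compMeasurePreserving f (measurePreserving_sub_right volume s)

theorem norm_transOp (s : ℝ) (f : LpR p) : ‖transOp s f‖ = ‖f‖ :=
  LinearIsometry.norm_map _ f

theorem norm_transOp_le (s : ℝ) : ‖(transOp s : LpR p →L[ℂ] LpR p)‖ ≤ 1 :=
  LinearIsometry.norm_toContinuousLinearMap_le _

theorem eq_transOp_iff {s : ℝ} {T : LpR p →L[ℂ] LpR p} :
    IsTransOp p s T ↔ T = transOp s := by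
  refine ⟨fun h => ?_, fun h f => h ▸ coeFn_transOp s f⟩
  ext1 f
  exact Lp.ext ((h f).trans (coeFn_transOp s f).symm)

theorem transOp_zero (f : LpR p) : transOp 0 f = f := by
  refine Lp.ext ?_
  filter_upwards [coeFn_transOp 0 f] with x h
  simp [h]

theorem Continuous.transOp_apply (hp' : p ≠ ⊤) {X : Type*} [TopologicalSpace X] {s : X → ℝ}
    {f : X → LpR p} (hs : Continuous s) (hf : Continuous f) :
    Continuous fun z => transOp (s z) (f z) := by
  let g : C(X, C(ℝ, ℝ)) :=
    (ContinuousMap.mk (fun a : X × ℝ => a.2 - s a.1) (by fun_prop)).curry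
  exact hf.compMeasurePreservingLp g.continuous
    (fun z => measurePreserving_sub_right volume (s z)) hp'

theorem Continuous.mulOp_apply (hp' : p ≠ ⊤) {X : Type*} [TopologicalSpace X]
    [FirstCountableTopology X] {φ : X → ℝ →ᵇ ℂ} {f : X → LpR p} {C : ℝ} (hC : ∀ i, ‖φ i‖ ≤ C)
    (hφ : ∀ x, Continuous fun z => φ z x) (hf : Continuous f) :
    Continuous fun z => mulOp (φ z) (f z) := by
  rw [continuous_iff_continuousAt]
  intro z
  have h1 : Tendsto (fun i => mulOp (φ i) (f z)) (𝓝 z) (𝓝 (mulOp (φ z) (f z))) :=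
    tendsto_mulOp hp' hC (fun x => (hφ x).tendsto z) (f z)
  have h2 : Tendsto (fun i => mulOp (φ i) (f i - f z)) (𝓝 z) (𝓝 0) := by
    have h3 : Tendsto (fun i => C * ‖f i - f z‖) (𝓝 z) (𝓝 0) := by
      simpa using (((hf.tendsto z).sub_const (f z)).norm).const_mul C
    refine squeeze_zero_norm (fun i => ?_) h3
    exact (ContinuousLinearMap.le_of_opNorm_le _ ((norm_mulOp_le _).trans (hC i)) _)
  have h4 := h2.add h1
  rw [zero_add] at h4
  refine h4.congr fun i => ?_
  rw [map_sub, sub_add_cancel]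

end Operators

section VectorIntegrals

theorem Submodule.integral_mem_of_isClosed {E : Type*} [NormedAddCommGroup E] [NormedSpace ℂ E]
    [CompleteSpace E] {X : Type*} [MeasurableSpace X] {μ : Measure X} {K : Submodule ℂ E}
    (hK : IsClosed (K : Set E)) {f : X → E} (hf : ∀ x, f x ∈ K) : ∫ x, f x ∂μ ∈ K := by
  by_cases hi : Integrable f μ
  · have : IsClosed (K : Set E) := hK
    have h := (K.mkQL).integral_comp_comm hi
    have h0 : ∀ x, K.mkQL (f x) = 0 := fun x => (Submodule.Quotient.mk_eq_zero K).2 (hf x)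
    simp only [h0, integral_zero] at h
    exact (Submodule.Quotient.mk_eq_zero K).1 h.symm
  · rw [integral_undef hi]; exact K.zero_mem

variable {p : ℝ≥0∞} [Fact (1 ≤ p)]

theorem exists_eLpNorm_one_restrict_le {s : Set ℝ} (hs : volume s < ⊤) :
    ∃ c : ℝ≥0∞, c ≠ ⊤ ∧ ∀ f : LpR p, eLpNorm f 1 (volume.restrict s) ≤ ‖f‖ₑ * c := by
  have hp1 : (1 : ℝ≥0∞) ≤ p := Fact.out
  refine ⟨(volume.restrict s) Set.univ ^ (1 / (1 : ℝ≥0∞).toReal - 1 / p.toReal), ?_, fun f => ?_⟩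
  · refine ENNReal.rpow_ne_top_of_nonneg ?_ (by simpa using hs.ne)
    rw [ENNReal.toReal_one, div_one, sub_nonneg]
    by_cases hpt : p = ⊤
    · simp [hpt]
    · rw [div_le_one (ENNReal.toReal_pos (zero_lt_one.trans_le hp1).ne' hpt)]
      exact (ENNReal.toReal_mono hpt hp1)
  · rw [Lp.enorm_def]
    refine (eLpNorm_le_eLpNorm_mul_rpow_measure_univ hp1
      (Lp.aestronglyMeasurable f).restrict).trans ?_
    gcongr
    exact Measure.restrict_le_self

theorem integrable_prod_restrict_of_integrable_Lp {G : ℝ → LpR p} (hG : Integrable G)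
    {g : ℝ × ℝ → ℂ} (hg : AEStronglyMeasurable g (volume.prod volume))
    (h : ∀ᵐ t, (G t : ℝ → ℂ) =ᵐ[volume] fun x => g (t, x)) {s : Set ℝ}
    (hs : volume s < ⊤) :
    Integrable g (volume.prod (volume.restrict s)) := by
  have hg' : AEStronglyMeasurable g (volume.prod (volume.restrict s)) := by
    refine hg.mono_ac (Measure.AbsolutelyContinuous.rfl.prod
      Measure.restrict_le_self.absolutelyContinuous)
  refine ⟨hg', ?_⟩
  rw [HasFiniteIntegral, lintegral_prod _ hg'.enorm]
  obtain ⟨c, hcfin, hc⟩ := exists_eLpNorm_one_restrict_le (p := p) hs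
  have hle : ∀ᵐ t, ∫⁻ x in s, ‖g (t, x)‖ₑ ≤ ‖G t‖ₑ * c := by
    filter_upwards [h] with t ht
    have h1 : ∫⁻ x in s, ‖g (t, x)‖ₑ = eLpNorm (G t) 1 (volume.restrict s) := by
      rw [eLpNorm_one_eq_lintegral_enorm]
      refine lintegral_congr_ae ?_
      filter_upwards [ae_restrict_of_ae ht] with x hx
      rw [hx]
    rw [h1]
    exact hc (G t)
  refine (lintegral_mono_ae hle).trans_lt ?_
  rw [lintegral_mul_const' _ _ hcfin]
  exact ENNReal.mul_lt_top hG.2 hcfin.lt_top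

/-- The integral over a set of finite measure, as a continuous functional on `L^p(ℝ)`. -/
theorem exists_clm_eq_setIntegral {s : Set ℝ} (hs : volume s < ⊤) :
    ∃ L : LpR p →L[ℂ] ℂ, ∀ f : LpR p, L f = ∫ x in s, f x := by
  have hp1 : (1 : ℝ≥0∞) ≤ p := Fact.out
  have : IsFiniteMeasure (volume.restrict s) := ⟨by simpa using hs⟩
  have hmem : ∀ f : LpR p, MemLp f 1 (volume.restrict s) := fun f =>
    ((Lp.memLp f).restrict s).mono_exponent hp1
  have hint : ∀ f : LpR p, Integrable f (volume.restrict s) := fun f =>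
    memLp_one_iff_integrable.1 (hmem f)
  obtain ⟨c, hcfin, hc⟩ := exists_eLpNorm_one_restrict_le (p := p) hs
  refine ⟨LinearMap.mkContinuous
    { toFun := fun f => ∫ x in s, f x
      map_add' := fun f g => by
        rw [← integral_add (hint f) (hint g)]
        exact integral_congr_ae (ae_restrict_of_ae (Lp.coeFn_add f g))
      map_smul' := fun a f => by
        rw [RingHom.id_apply, ← integral_smul]
        exact integral_congr_ae (ae_restrict_of_ae (Lp.coeFn_smul a f)) }
    c.toReal (fun f => ?_), fun f => rfl⟩
  refine (norm_integral_le_lintegral_norm _).trans ?_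
  rw [← toReal_enorm, ← ENNReal.toReal_mul, mul_comm]
  refine ENNReal.toReal_mono (ENNReal.mul_ne_top enorm_ne_top hcfin) ?_
  simp_rw [ofReal_norm]
  rw [← eLpNorm_one_eq_lintegral_enorm]
  exact hc f

/-- A Bochner integral in `L^p(ℝ)` may be evaluated pointwise almost everywhere. -/
theorem coeFn_integral_Lp {G : ℝ → LpR p} (hG : Integrable G)
    {g : ℝ × ℝ → ℂ} (hg : AEStronglyMeasurable g (volume.prod volume))
    (h : ∀ᵐ t, (G t : ℝ → ℂ) =ᵐ[volume] fun x => g (t, x)) :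
    ((∫ t, G t : LpR p) : ℝ → ℂ) =ᵐ[volume] fun x => ∫ t, g (t, x) := by
  have hp1 : (1 : ℝ≥0∞) ≤ p := Fact.out
  refine ae_eq_of_forall_setIntegral_eq_of_sigmaFinite (fun s _ hs => ?_) (fun s _ hs => ?_)
    (fun s _ hs => ?_)
  · have : IsFiniteMeasure (volume.restrict s) := ⟨by simpa using hs⟩
    exact memLp_one_iff_integrable.1 (((Lp.memLp _).restrict s).mono_exponent hp1)
  · exact (integrable_prod_restrict_of_integrable_Lp hG hg h hs).integral_prod_right
  · obtain ⟨L, hL⟩ := exists_clm_eq_setIntegral (p := p) hs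
    rw [← hL, ← L.integral_comp_comm hG,
      ← integral_integral_swap
        (f := fun t x => g (t, x)) (integrable_prod_restrict_of_integrable_Lp hG hg h hs)]
    refine integral_congr_ae ?_
    filter_upwards [h] with t ht
    rw [hL]
    exact integral_congr_ae (ae_restrict_of_ae ht)

theorem integrable_apply_of_norm_le {A : ℝ → LpR p →L[ℂ] LpR p} {b : ℝ → ℝ} (hb : Integrable b)
    (hA : ∀ t, ‖A t‖ ≤ b t) (hm : ∀ f, AEStronglyMeasurable (fun t => A t f) volume)
    (f : LpR p) : Integrable (fun t => A t f) :=
  (hb.mul_const ‖f‖).mono' (hm f)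
    (Eventually.of_forall fun t => (A t).le_of_opNorm_le (hA t) f)

/-- The strong integral `f ↦ ∫ A t f` of a family of operators. -/
def intOp (A : ℝ → LpR p →L[ℂ] LpR p) (b : ℝ → ℝ) (hb : Integrable b)
    (hA : ∀ t, ‖A t‖ ≤ b t) (hm : ∀ f, AEStronglyMeasurable (fun t => A t f) volume) :
    LpR p →L[ℂ] LpR p :=
  have hi := integrable_apply_of_norm_le hb hA hm
  LinearMap.mkContinuous
    { toFun := fun f => ∫ t, A t f
      map_add' := fun f g => by
        simp_rw [map_add]; exact integral_add (hi f) (hi g)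
      map_smul' := fun c f => by
        simp_rw [map_smul]; exact integral_smul c _ }
    (∫ t, b t) (fun f => by
      rw [← integral_mul_const]
      exact norm_integral_le_of_norm_le (hb.mul_const ‖f‖)
        (Eventually.of_forall fun t => (A t).le_of_opNorm_le (hA t) f))

theorem intOp_apply (A : ℝ → LpR p →L[ℂ] LpR p) (b : ℝ → ℝ) (hb : Integrable b)
    (hA : ∀ t, ‖A t‖ ≤ b t) (hm : ∀ f, AEStronglyMeasurable (fun t => A t f) volume)
    (f : LpR p) : intOp A b hb hA hm f = ∫ t, A t f := rfl

end VectorIntegrals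

section StrongClosure

variable {p : ℝ≥0∞} [Fact (1 ≤ p)]

theorem IsSOTClosed.mem_of_finset {S : Set (LpR p →L[ℂ] LpR p)} (hS : IsSOTClosed p S)
    {T : LpR p →L[ℂ] LpR p}
    (h : ∀ I : Finset (LpR p), (fun i : I => T i) ∈
      closure ((fun (A : LpR p →L[ℂ] LpR p) (i : I) => A i) '' S)) : T ∈ S := by
  refine hS T (mem_closure_iff_nhds.2 fun U hU => ?_)
  rw [nhds_pi, Filter.mem_pi'] at hU
  obtain ⟨I, t, ht, hIU⟩ := hU
  have hV : Set.pi Set.univ (fun i : I => t i) ∈ 𝓝 (fun i : I => T i) :=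
    set_pi_mem_nhds Set.finite_univ fun i _ => ht i
  obtain ⟨_, hy, A, hA, rfl⟩ := mem_closure_iff_nhds.1 (h I) _ hV
  exact ⟨A, hIU fun i hi => hy ⟨i, hi⟩ trivial, A, hA, rfl⟩

theorem IsSOTClosed.mem_of_tendsto {S : Set (LpR p →L[ℂ] LpR p)} (hS : IsSOTClosed p S)
    {ι : Type*} {l : Filter ι} [l.NeBot] {A : ι → LpR p →L[ℂ] LpR p} (hA : ∀ i, A i ∈ S)
    {T : LpR p →L[ℂ] LpR p} (h : ∀ f, Tendsto (fun i => A i f) l (𝓝 (T f))) : T ∈ S :=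
  hS T (mem_closure_of_tendsto (tendsto_pi_nhds.2 h)
    (Eventually.of_forall fun i => ⟨A i, hA i, rfl⟩))

theorem IsSOTClosed.intOp_mem {S : Subalgebra ℂ (LpR p →L[ℂ] LpR p)}
    (hS : IsSOTClosed p (S : Set (LpR p →L[ℂ] LpR p)))
    {A : ℝ → LpR p →L[ℂ] LpR p} {b : ℝ → ℝ} (hb : Integrable b)
    (hA : ∀ t, ‖A t‖ ≤ b t) (hm : ∀ f, AEStronglyMeasurable (fun t => A t f) volume)
    (h : ∀ t, A t ∈ S) : intOp A b hb hA hm ∈ S := by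
  refine hS.mem_of_finset fun I => ?_
  let ev : (LpR p →L[ℂ] LpR p) →ₗ[ℂ] (I → LpR p) :=
    { toFun := fun B i => B i
      map_add' := fun _ _ => rfl
      map_smul' := fun _ _ => rfl }
  let K : Submodule ℂ (I → LpR p) := ((Subalgebra.toSubmodule S).map ev).topologicalClosure
  have hint : ∀ i : I, Integrable (fun t => ev (A t) i) := fun i =>
    integrable_apply_of_norm_le hb hA hm i
  have hmem : ∫ t, ev (A t) ∈ K :=
    Submodule.integral_mem_of_isClosed (Submodule.isClosed_topologicalClosure _) fun t =>
      Submodule.le_topologicalClosure _ ⟨A t, h t, rfl⟩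
  have heq : (fun i : I => intOp A b hb hA hm i) = ∫ t, ev (A t) := by
    funext i
    rw [intOp_apply, eval_integral hint i]
    rfl
  rw [heq]
  exact hmem

/-- The algebra of operators leaving invariant every subspace in a family. -/
def invAlg (𝒦 : Set (Submodule ℂ (LpR p))) : Subalgebra ℂ (LpR p →L[ℂ] LpR p) where
  carrier := {T | ∀ K ∈ 𝒦, ∀ f ∈ K, T f ∈ K}
  mul_mem' := fun {S T} hS hT K hK f hf => hS K hK _ (hT K hK f hf)
  add_mem' := fun {S T} hS hT K hK f hf => K.add_mem (hS K hK f hf) (hT K hK f hf)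
  algebraMap_mem' := fun c K _ f hf => by
    rw [Algebra.algebraMap_eq_smul_one]; exact K.smul_mem c hf

theorem mem_invAlg {𝒦 : Set (Submodule ℂ (LpR p))} {T : LpR p →L[ℂ] LpR p} :
    T ∈ invAlg 𝒦 ↔ ∀ K ∈ 𝒦, ∀ f ∈ K, T f ∈ K := Iff.rfl

theorem isSOTClosed_invAlg {𝒦 : Set (Submodule ℂ (LpR p))}
    (h𝒦 : ∀ K ∈ 𝒦, IsClosed (K : Set (LpR p))) :
    IsSOTClosed p (invAlg 𝒦 : Set (LpR p →L[ℂ] LpR p)) := by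
  intro T hT K hK f hf
  have h1 : IsClosed {F : LpR p → LpR p | F f ∈ K} := (h𝒦 K hK).preimage (continuous_apply f)
  refine closure_minimal ?_ h1 hT
  rintro _ ⟨A, hA, rfl⟩
  exact hA K hK f hf

end StrongClosure

section Cauchy

theorem add_ne_zero_of_im_pos {u : ℂ} (hu : 0 < u.im) (x : ℝ) : (x : ℂ) + u ≠ 0 := fun h => by
  have := congrArg Complex.im h
  simp at this
  exact hu.ne' this

theorem norm_inv_add_le {u : ℂ} (hu : 0 < u.im) (x : ℝ) :
    ‖((x : ℂ) + u)⁻¹‖ ≤ ((1 + ‖u‖) / u.im + 1) * (1 + |x|)⁻¹ := by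
  have h0 : 0 < ‖(x : ℂ) + u‖ := norm_pos_iff.2 (add_ne_zero_of_im_pos hu x)
  have h1 : u.im ≤ ‖(x : ℂ) + u‖ := by
    have := (le_abs_self _).trans (Complex.abs_im_le_norm ((x : ℂ) + u))
    simpa using this
  have h2 : |x| ≤ ‖(x : ℂ) + u‖ + ‖u‖ := by
    have := norm_sub_le ((x : ℂ) + u) u
    simpa using this
  have h3 : 0 < 1 + |x| := by positivity
  rw [norm_inv, ← div_eq_mul_inv, inv_eq_one_div, div_le_div_iff₀ h0 h3, one_mul]
  have h4 : 1 + ‖u‖ ≤ (1 + ‖u‖) / u.im * ‖(x : ℂ) + u‖ := by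
    rw [div_mul_eq_mul_div, le_div_iff₀ hu]
    gcongr
  linarith

theorem memLp_of_norm_le_inv {r : ℝ≥0∞} (hr : 1 < r) (hr' : r ≠ ⊤) {g : ℝ → ℂ}
    (hg : AEStronglyMeasurable g volume) {C : ℝ} (h : ∀ x, ‖g x‖ ≤ C * (1 + |x|)⁻¹) :
    MemLp g r volume := by
  have hr0 : r ≠ 0 := (zero_lt_one.trans hr).ne'
  have h1 : 1 < r.toReal := by
    have := ENNReal.toReal_strict_mono hr' hr
    simpa using this
  have hm : AEStronglyMeasurable (fun x : ℝ => (1 + |x|)⁻¹) volume := by fun_prop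
  have hw : MemLp (fun x : ℝ => (1 + |x|)⁻¹) r volume := by
    rw [← integrable_norm_rpow_iff hm hr0 hr']
    refine (integrable_one_add_norm (E := ℝ) (μ := volume) (r := r.toReal)
      (by simpa using h1)).congr (Eventually.of_forall fun x => ?_)
    have : 0 < 1 + |x| := by positivity
    simp only [Real.norm_eq_abs, abs_inv, abs_of_pos this]
    rw [Real.rpow_neg this.le, Real.inv_rpow this.le]
  refine hw.of_le_mul (c := C) hg (Eventually.of_forall fun x => ?_)
  rw [Real.norm_eq_abs, abs_of_pos (by positivity)]
  exact h x

theorem continuous_inv_add {u : ℂ} (hu : 0 < u.im) : Continuous fun x : ℝ => ((x : ℂ) + u)⁻¹ :=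
  (Complex.continuous_ofReal.add continuous_const).inv₀ (add_ne_zero_of_im_pos hu)

theorem memLp_inv_add {r : ℝ≥0∞} (hr : 1 < r) (hr' : r ≠ ⊤) {u : ℂ} (hu : 0 < u.im) :
    MemLp (fun x : ℝ => ((x : ℂ) + u)⁻¹) r volume :=
  memLp_of_norm_le_inv hr hr' (continuous_inv_add hu).aestronglyMeasurable (norm_inv_add_le hu)

theorem tendsto_ofReal_add_cobounded (u : ℂ) :
    Tendsto (fun x : ℝ => (x : ℂ) + u) (Bornology.cobounded ℝ) (Bornology.cobounded ℂ) := by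
  rw [← tendsto_norm_atTop_iff_cobounded]
  have h3 : Tendsto (fun x : ℝ => ‖x‖ - ‖u‖) (Bornology.cobounded ℝ) atTop :=
    tendsto_atTop_add_const_right _ _ tendsto_norm_cobounded_atTop
  refine tendsto_atTop_mono (fun x => ?_) h3
  have := norm_sub_norm_le (x : ℂ) (-u)
  simpa using this

theorem tendsto_log_sub_log {u v : ℂ} (hu : 0 < u.im) (hv : 0 < v.im) :
    Tendsto (fun x : ℝ => Complex.log (x + v) - Complex.log (x + u))
      (Bornology.cobounded ℝ) (𝓝 0) := by
  have h1 : Tendsto (fun x : ℝ => 1 + (v - u) * ((x : ℂ) + u)⁻¹) (Bornology.cobounded ℝ)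
      (𝓝 1) := by
    simpa using ((tendsto_inv₀_cobounded.comp (tendsto_ofReal_add_cobounded u)).const_mul
      (v - u)).const_add 1
  have h4 := (_root_.continuousAt_clog Complex.one_mem_slitPlane).tendsto.comp h1
  rw [Complex.log_one] at h4
  refine h4.congr fun x => ?_
  have hu0 := add_ne_zero_of_im_pos hu x
  have hv0 := add_ne_zero_of_im_pos hv x
  have him : (Complex.log (x + v) - Complex.log (x + u)).im
      = Complex.arg (x + v) - Complex.arg (x + u) := by
    simp [Complex.log_im]
  have a1 : 0 ≤ Complex.arg (x + v) := Complex.arg_nonneg_iff.2 (by simpa using hv.le)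
  have a2 : 0 ≤ Complex.arg (x + u) := Complex.arg_nonneg_iff.2 (by simpa using hu.le)
  have a3 : Complex.arg (x + u) < Real.pi :=
    Complex.arg_lt_pi_iff.2 (Or.inr (by simpa using hu.ne'))
  have a4 := Complex.arg_le_pi (x + v)
  have hexp : Complex.exp (Complex.log (x + v) - Complex.log (x + u))
      = 1 + (v - u) * ((x : ℂ) + u)⁻¹ := by
    rw [Complex.exp_sub, Complex.exp_log hv0, Complex.exp_log hu0]
    field_simp
    ring
  simp only [Function.comp]
  rw [← hexp, Complex.log_exp (by rw [him]; linarith) (by rw [him]; linarith)]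

theorem integrable_inv_add_mul_inv_add {u v : ℂ} (hu : 0 < u.im) (hv : 0 < v.im) :
    Integrable fun x : ℝ => ((x : ℂ) + v)⁻¹ * ((x : ℂ) + u)⁻¹ :=
  (memLp_inv_add (r := 2) (by norm_num) (by norm_num) hv).integrable_mul
    (memLp_inv_add (r := 2) (by norm_num) (by norm_num) hu)

theorem integral_inv_add_mul_inv_add {u v : ℂ} (hu : 0 < u.im) (hv : 0 < v.im) :
    ∫ x : ℝ, ((x : ℂ) + v)⁻¹ * ((x : ℂ) + u)⁻¹ = 0 := by
  have hcob : ∀ {F : ℝ → ℂ}, Tendsto F (Bornology.cobounded ℝ) (𝓝 0) →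
      Tendsto F atBot (𝓝 0) ∧ Tendsto F atTop (𝓝 0) := fun h =>
    ⟨h.mono_left (by rw [IsOrderBornology.cobounded_eq]; exact le_sup_left),
      h.mono_left (by rw [IsOrderBornology.cobounded_eq]; exact le_sup_right)⟩
  have hadd : ∀ (w : ℂ) (x : ℝ), HasDerivAt (fun x : ℝ => (x : ℂ) + w) 1 x := fun w x =>
    ((hasDerivAt_id x).ofReal_comp).add_const w
  have hlog : ∀ {w : ℂ}, 0 < w.im → ∀ x : ℝ,
      HasDerivAt (fun x : ℝ => Complex.log (x + w)) (((x : ℂ) + w)⁻¹) x := fun {w} hw x => by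
    have := (hadd w x).clog_real (Or.inr (by simpa using hw.ne'))
    simpa using this
  by_cases huv : u = v
  · subst huv
    have h2 : Tendsto (fun x : ℝ => -((x : ℂ) + u)⁻¹) (Bornology.cobounded ℝ) (𝓝 0) := by
      simpa using (tendsto_inv₀_cobounded.comp (tendsto_ofReal_add_cobounded u)).neg
    rw [integral_of_hasDerivAt_of_tendsto (f := fun x : ℝ => -((x : ℂ) + u)⁻¹) (fun x => ?_)
      (integrable_inv_add_mul_inv_add hu hu) (hcob h2).1 (hcob h2).2, sub_zero]
    have h0 := add_ne_zero_of_im_pos hu x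
    refine ((hadd u x).fun_inv h0).fun_neg.congr_deriv ?_
    field_simp
    try ring
  · have h := hcob (tendsto_log_sub_log hu hv)
    have hd : ∀ x : ℝ, HasDerivAt (fun x : ℝ => Complex.log (x + v) - Complex.log (x + u))
        ((u - v) * (((x : ℂ) + v)⁻¹ * ((x : ℂ) + u)⁻¹)) x := fun x => by
      have hu0 := add_ne_zero_of_im_pos hu x
      have hv0 := add_ne_zero_of_im_pos hv x
      refine ((hlog hv x).fun_sub (hlog hu x)).congr_deriv ?_
      field_simp
      ring
    have h3 := integral_of_hasDerivAt_of_tendsto hd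
      ((integrable_inv_add_mul_inv_add hu hv).const_mul _) h.1 h.2
    rw [integral_const_mul, sub_zero] at h3
    exact (mul_eq_zero.1 h3).resolve_left (sub_ne_zero.2 huv)

end Cauchy

section Pairing

theorem one_lt_conjExponent {p : ℝ≥0∞} (hp' : p ≠ ⊤) : 1 < p.conjExponent := by
  rw [ENNReal.conjExponent]
  refine ENNReal.lt_add_right (by simp) ?_
  simp [hp']

theorem conjExponent_ne_top {p : ℝ≥0∞} (hp : 1 < p) : p.conjExponent ≠ ⊤ := by
  rw [ENNReal.conjExponent]
  simpa [tsub_eq_zero_iff_le] using hp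

variable {p : ℝ≥0∞} [Fact (1 ≤ p)]

/-- The functional `f ↦ ∫ g f` on `L^p(ℝ)` given by a function `g` in the dual space. -/
def pairing (g : ℝ → ℂ) (hg : MemLp g p.conjExponent volume) : LpR p →L[ℂ] ℂ :=
  haveI : Fact (1 ≤ p.conjExponent) := ⟨ENNReal.HolderConjugate.one_le p.conjExponent p⟩
  (ContinuousLinearMap.mul ℂ ℂ).lpPairing volume p.conjExponent p (hg.toLp g)

theorem pairing_apply {g : ℝ → ℂ} (hg : MemLp g p.conjExponent volume) (f : LpR p) :
    pairing g hg f = ∫ x, g x * f x := by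
  rw [pairing, ContinuousLinearMap.lpPairing_eq_integral]
  refine integral_congr_ae ?_
  filter_upwards [hg.coeFn_toLp] with x hx
  rw [hx]; rfl

end Pairing

section Multipliers

/-- The character `x ↦ e^{ilx}`. -/
def expB (l : ℝ) : ℝ →ᵇ ℂ :=
  BoundedContinuousFunction.ofNormedAddCommGroup (fun x : ℝ => Complex.exp (Complex.I * l * x))
    (by fun_prop) 1 (fun x => by
      rw [show Complex.I * l * x = ((l * x : ℝ) : ℂ) * Complex.I by push_cast; ring,
        Complex.norm_exp_ofReal_mul_I])

@[simp] theorem expB_apply (l x : ℝ) : expB l x = Complex.exp (Complex.I * l * x) := rfl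

theorem norm_expB_le (l : ℝ) : ‖expB l‖ ≤ 1 :=
  BoundedContinuousFunction.norm_ofNormedAddCommGroup_le _ zero_le_one _

theorem norm_expB_apply (l x : ℝ) : ‖expB l x‖ = 1 := by
  rw [expB_apply, show Complex.I * l * x = ((l * x : ℝ) : ℂ) * Complex.I by push_cast; ring,
    Complex.norm_exp_ofReal_mul_I]

theorem expB_mul (l m : ℝ) : expB l * expB m = expB (l + m) := by
  ext x
  simp only [BoundedContinuousFunction.mul_apply, expB_apply, ← Complex.exp_add]
  congr 1; push_cast; ring

theorem expB_zero : expB 0 = 1 := by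
  ext x; simp

theorem expB_apply_sub (l x s : ℝ) : expB l (x - s) = expB l (-s) * expB l x := by
  simp only [expB_apply, ← Complex.exp_add]
  congr 1; push_cast; ring

theorem one_le_norm_one_sub (a x : ℝ) : 1 ≤ ‖1 - Complex.I * a * x‖ := by
  have h := Complex.abs_re_le_norm (1 - Complex.I * a * x)
  have h2 : (1 - Complex.I * a * x).re = 1 := by simp
  rw [h2, abs_one] at h
  exact h

theorem one_sub_ne_zero' (a x : ℝ) : 1 - Complex.I * a * x ≠ 0 :=
  norm_pos_iff.1 (zero_lt_one.trans_le (one_le_norm_one_sub a x))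

/-- The resolvent multiplier `x ↦ (1 - iax)⁻¹`. -/
def resB (a : ℝ) : ℝ →ᵇ ℂ :=
  BoundedContinuousFunction.ofNormedAddCommGroup (fun x : ℝ => (1 - Complex.I * a * x)⁻¹)
    (Continuous.inv₀ (by fun_prop) (one_sub_ne_zero' a)) 1 (fun x => by
      rw [norm_inv]; exact inv_le_one_of_one_le₀ (one_le_norm_one_sub a x))

@[simp] theorem resB_apply (a x : ℝ) : resB a x = (1 - Complex.I * a * x)⁻¹ := rfl

theorem norm_resB_le (a : ℝ) : ‖resB a‖ ≤ 1 :=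
  BoundedContinuousFunction.norm_ofNormedAddCommGroup_le _ zero_le_one _

theorem resB_zero : resB 0 = 1 := by
  ext x; simp

theorem resB_apply_eq {a : ℝ} (ha : 0 < a) (x : ℝ) :
    resB a x = (Complex.I / a) * ((x : ℂ) + Complex.I / a)⁻¹ := by
  have h := one_sub_ne_zero' a x
  have ha' : (a : ℂ) ≠ 0 := by exact_mod_cast ha.ne'
  have h2 : (x : ℂ) + Complex.I / a = (Complex.I / a) * (1 - Complex.I * a * x) := by
    field_simp
    linear_combination ((a : ℂ) * x) * Complex.I_sq
  rw [resB_apply, h2, mul_inv, mul_inv_cancel_left₀ (div_ne_zero Complex.I_ne_zero ha')]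

theorem I_div_im_pos {a : ℝ} (ha : 0 < a) : 0 < (Complex.I / (a : ℂ)).im := by
  rw [Complex.div_ofReal_im, Complex.I_im]; positivity

theorem continuous_resB_apply (x : ℝ) : Continuous fun a => resB a x := by
  simp only [resB_apply]
  exact Continuous.inv₀ (by fun_prop) (fun a => one_sub_ne_zero' a x)

end Multipliers

section Hardy

theorem memLp_cauchy_conj {p : ℝ≥0∞} (hp : 1 < p) (hp' : p ≠ ⊤) {u : ℂ} (hu : 0 < u.im) :
    MemLp (fun x : ℝ => ((x : ℂ) + u)⁻¹) p.conjExponent volume :=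
  memLp_inv_add (one_lt_conjExponent hp') (conjExponent_ne_top hp) hu

variable {p : ℝ≥0∞} [Fact (1 ≤ p)]

theorem integrable_div_add (hp : 1 < p) (hp' : p ≠ ⊤) {u : ℂ} (hu : 0 < u.im) (f : LpR p) :
    Integrable fun x : ℝ => f x / ((x : ℂ) + u) := by
  simp_rw [div_eq_mul_inv]
  exact (Lp.memLp f).integrable_mul (memLp_cauchy_conj hp hp' hu)

/-- The functional `f ↦ ∫ f(x)/(x+u) dx`. -/
def cauchyL (hp : 1 < p) (hp' : p ≠ ⊤) (u : ℂ) (hu : 0 < u.im) : LpR p →L[ℂ] ℂ :=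
  pairing _ (memLp_cauchy_conj hp hp' hu)

theorem cauchyL_apply (hp : 1 < p) (hp' : p ≠ ⊤) {u : ℂ} (hu : 0 < u.im) (f : LpR p) :
    cauchyL hp hp' u hu f = ∫ x : ℝ, f x / ((x : ℂ) + u) := by
  rw [cauchyL, pairing_apply]
  simp_rw [div_eq_inv_mul]

/-- The Hardy space as a submodule of `L^p(ℝ)`. -/
def hardySub (hp : 1 < p) (hp' : p ≠ ⊤) : Submodule ℂ (LpR p) :=
  ⨅ (u : ℂ) (hu : 0 < u.im), (cauchyL hp hp' u hu).ker

theorem mem_hardySub (hp : 1 < p) (hp' : p ≠ ⊤) {f : LpR p} :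
    f ∈ hardySub hp hp' ↔ f ∈ hardy p := by
  simp only [hardySub, Submodule.mem_iInf, LinearMap.mem_ker, hardy, Set.mem_ofPred_eq]
  exact forall₂_congr fun u hu => by
    rw [← cauchyL_apply hp hp' hu f]; rfl

theorem isClosed_hardySub (hp : 1 < p) (hp' : p ≠ ⊤) :
    IsClosed (hardySub hp hp' : Set (LpR p)) := by
  simp only [hardySub, Submodule.coe_iInf]
  exact isClosed_iInter fun u => isClosed_iInter fun hu =>
    (cauchyL hp hp' u hu).isClosed_ker

theorem transOp_mem_hardySub (hp : 1 < p) (hp' : p ≠ ⊤) {f : LpR p}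
    (hf : f ∈ hardySub hp hp') (s : ℝ) : transOp s f ∈ hardySub hp hp' := by
  rw [mem_hardySub] at hf ⊢
  intro u hu
  have h := hf (u + s) (by simpa using hu)
  rw [← h, ← integral_sub_right_eq_self (fun x : ℝ => f x / ((x : ℂ) + (u + s))) s]
  refine integral_congr_ae ?_
  filter_upwards [coeFn_transOp s f] with x hx
  rw [hx]
  congr 1
  push_cast; ring

theorem resB_mul_mem_hardySub (hp : 1 < p) (hp' : p ≠ ⊤) {f : LpR p}
    (hf : f ∈ hardySub hp hp') {a : ℝ} (ha : 0 ≤ a) : mulOp (resB a) f ∈ hardySub hp hp' := by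
  have hne : ∀ {a : ℝ}, 0 < a → ∀ {u : ℂ}, 0 < u.im → u ≠ Complex.I / a →
      ∫ x : ℝ, mulOp (resB a) f x / ((x : ℂ) + u) = 0 := by
    intro a ha u hu hua
    have hv := I_div_im_pos ha
    rw [mem_hardySub] at hf
    have h1 := integrable_div_add hp hp' hu f
    have h2 := integrable_div_add hp hp' hv f
    have h3 : ∫ x : ℝ, mulOp (resB a) f x / ((x : ℂ) + u) =
        ∫ x : ℝ, (Complex.I / a) / (u - Complex.I / a) *
          (f x / ((x : ℂ) + Complex.I / a) - f x / ((x : ℂ) + u)) := by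
      refine integral_congr_ae ?_
      filter_upwards [coeFn_mulOp (resB a) f] with x hx
      rw [hx, resB_apply_eq ha]
      have e1 := add_ne_zero_of_im_pos hu x
      have e2 := add_ne_zero_of_im_pos hv x
      have e3 := sub_ne_zero.2 hua
      generalize Complex.I / (a : ℂ) = v at *
      field_simp
      ring
    rw [h3, integral_const_mul, integral_sub h2 h1, hf _ hu, hf _ hv, sub_zero, mul_zero]
  rcases ha.eq_or_lt with rfl | ha
  · rwa [resB_zero, mulOp_one]
  rw [mem_hardySub]
  intro u hu
  by_cases hua : u = Complex.I / a
  · have ht : Tendsto (fun b => cauchyL hp hp' u hu (mulOp (resB b) f)) (𝓝[>] a)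
        (𝓝 (cauchyL hp hp' u hu (mulOp (resB a) f))) :=
      ((cauchyL hp hp' u hu).continuous.tendsto _).comp
        ((tendsto_mulOp hp' (norm_resB_le ·) (fun x => (continuous_resB_apply x).tendsto a)
          f).mono_left nhdsWithin_le_nhds)
    rw [← cauchyL_apply hp hp' hu]
    refine tendsto_nhds_unique ht (tendsto_const_nhds.congr' ?_)
    filter_upwards [self_mem_nhdsWithin] with b hb
    have hb' : a < b := hb
    rw [cauchyL_apply, hne (ha.trans hb') hu]
    rw [hua]
    intro h
    have h2 : (a : ℂ) = b := by
      rw [div_eq_mul_inv, div_eq_mul_inv] at h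
      exact inv_injective (mul_left_cancel₀ Complex.I_ne_zero h)
    exact hb'.ne (by exact_mod_cast h2)
  · exact hne ha hu hua

theorem resB_pow_mul_mem_hardySub (hp : 1 < p) (hp' : p ≠ ⊤) {f : LpR p}
    (hf : f ∈ hardySub hp hp') {a : ℝ} (ha : 0 ≤ a) (n : ℕ) :
    mulOp (resB a ^ n) f ∈ hardySub hp hp' := by
  induction n with
  | zero => rwa [pow_zero, mulOp_one]
  | succ n ih =>
    rw [pow_succ', ← mulOp_comp]
    exact resB_mul_mem_hardySub hp hp' ih ha

theorem norm_pow_resB_le (a : ℝ) (n : ℕ) : ‖resB a ^ n‖ ≤ 1 :=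
  (norm_pow_le _ n).trans (pow_le_one₀ (norm_nonneg _) (norm_resB_le a))

theorem expB_mul_mem_hardySub (hp : 1 < p) (hp' : p ≠ ⊤) {f : LpR p}
    (hf : f ∈ hardySub hp hp') {l : ℝ} (hl : 0 ≤ l) : mulOp (expB l) f ∈ hardySub hp hp' := by
  have ht : Tendsto (fun n : ℕ => mulOp (resB (l / n) ^ n) f) atTop (𝓝 (mulOp (expB l) f)) := by
    refine tendsto_mulOp hp' (C := 1) (fun n => norm_pow_resB_le _ _) (fun x => ?_) f
    have h1 := (Complex.tendsto_one_add_div_pow_exp (-(Complex.I * l * x))).inv₀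
      (Complex.exp_ne_zero _)
    rw [← Complex.exp_neg, neg_neg] at h1
    refine h1.congr fun n => ?_
    rw [BoundedContinuousFunction.pow_apply, resB_apply, inv_pow]
    congr 2
    push_cast; ring
  exact (isClosed_hardySub hp hp').mem_of_tendsto ht (Eventually.of_forall fun n =>
    resB_pow_mul_mem_hardySub hp hp' hf (by positivity) n)

theorem memLp_resB {p : ℝ≥0∞} (hp : 1 < p) (hp' : p ≠ ⊤) {a : ℝ} (ha : 0 < a) :
    MemLp (resB a) p volume := by
  have := (memLp_inv_add hp hp' (I_div_im_pos ha)).const_mul (Complex.I / a)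
  exact this.ae_eq (Eventually.of_forall fun x => (resB_apply_eq ha x).symm)

theorem toLp_resB_mem_hardySub (hp : 1 < p) (hp' : p ≠ ⊤) {a : ℝ} (ha : 0 < a) :
    (memLp_resB hp hp' ha).toLp _ ∈ hardySub hp hp' := by
  rw [mem_hardySub]
  intro u hu
  have h1 : ∫ x : ℝ, (memLp_resB hp hp' ha).toLp _ x / ((x : ℂ) + u) =
      ∫ x : ℝ, (Complex.I / a) * (((x : ℂ) + Complex.I / a)⁻¹ * ((x : ℂ) + u)⁻¹) := by
    refine integral_congr_ae ?_
    filter_upwards [(memLp_resB hp hp' ha).coeFn_toLp] with x hx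
    rw [hx, resB_apply_eq ha, div_eq_mul_inv, mul_assoc]
  rw [h1, integral_const_mul, integral_inv_add_mul_inv_add hu (I_div_im_pos ha), mul_zero]

theorem integral_resB_mul_eq_zero (hp : 1 < p) (hp' : p ≠ ⊤) {f : LpR p}
    (hf : f ∈ hardySub hp hp') {a : ℝ} (ha : 0 < a) : ∫ x, resB a x * f x = 0 := by
  rw [mem_hardySub] at hf
  have h := hf _ (I_div_im_pos ha)
  simp_rw [resB_apply_eq ha, mul_assoc]
  rw [integral_const_mul]
  simp_rw [← div_eq_inv_mul]
  rw [h, mul_zero]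

/-- The translate `e^{ilx}H^p(ℝ)` of the Hardy space, as a submodule. -/
def mulHardySub (hp : 1 < p) (hp' : p ≠ ⊤) (l : ℝ) : Submodule ℂ (LpR p) :=
  (hardySub hp hp').comap (mulOp (expB (-l)) : LpR p →L[ℂ] LpR p).toLinearMap

theorem mem_mulHardySub (hp : 1 < p) (hp' : p ≠ ⊤) {l : ℝ} {f : LpR p} :
    f ∈ mulHardySub hp hp' l ↔ mulOp (expB (-l)) f ∈ hardySub hp hp' := Iff.rfl

theorem mem_mulHardySub_iff (hp : 1 < p) (hp' : p ≠ ⊤) {l : ℝ} {f : LpR p} :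
    f ∈ mulHardySub hp hp' l ↔ f ∈ mulHardy p (fun x => Complex.exp (Complex.I * l * x)) := by
  rw [mem_mulHardySub, mulHardy, Set.mem_ofPred_eq]
  constructor
  · intro h
    refine ⟨_, (mem_hardySub hp hp').1 h, ?_⟩
    have h1 : mulOp (expB l) (mulOp (expB (-l)) f) = f := by
      rw [mulOp_comp, expB_mul, add_neg_cancel, expB_zero, mulOp_one]
    nth_rewrite 1 [← h1]
    exact coeFn_mulOp _ _
  · rintro ⟨g, hg, hfg⟩
    have h1 : f = mulOp (expB l) g := Lp.ext (hfg.trans (coeFn_mulOp (expB l) g).symm)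
    rwa [h1, mulOp_comp, expB_mul, neg_add_cancel, expB_zero, mulOp_one, mem_hardySub]

theorem isClosed_mulHardySub (hp : 1 < p) (hp' : p ≠ ⊤) (l : ℝ) :
    IsClosed (mulHardySub hp hp' l : Set (LpR p)) :=
  (isClosed_hardySub hp hp').preimage (mulOp (expB (-l))).continuous

theorem mulOp_comm_apply (φ ψ : ℝ →ᵇ ℂ) (f : LpR p) :
    mulOp φ (mulOp ψ f) = mulOp ψ (mulOp φ f) := by
  rw [mulOp_comp, mulOp_comp, mul_comm]

theorem mulOp_expB_transOp (l s : ℝ) (f : LpR p) :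
    mulOp (expB l) (transOp s f) = expB l s • transOp s (mulOp (expB l) f) := by
  refine Lp.ext ?_
  have hq := (measurePreserving_sub_right (volume : Measure ℝ) s).quasiMeasurePreserving
  filter_upwards [coeFn_mulOp (expB l) (transOp s f), coeFn_transOp s f,
    Lp.coeFn_smul (expB l s) (transOp s (mulOp (expB l) f)),
    coeFn_transOp s (mulOp (expB l) f), hq.ae (coeFn_mulOp (expB l) f)] with x h1 h2 h3 h4 h5
  rw [h1, h2, h3, Pi.smul_apply, h4, h5, smul_eq_mul, expB_apply_sub, ← mul_assoc, ← mul_assoc]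
  congr 1
  rw [expB_apply, expB_apply, expB_apply, ← Complex.exp_add, ← Complex.exp_add]
  congr 1
  push_cast; ring

theorem transOp_mem_mulHardySub (hp : 1 < p) (hp' : p ≠ ⊤) {l : ℝ} {f : LpR p}
    (hf : f ∈ mulHardySub hp hp' l) (s : ℝ) : transOp s f ∈ mulHardySub hp hp' l := by
  rw [mem_mulHardySub] at hf ⊢
  rw [mulOp_expB_transOp]
  exact Submodule.smul_mem _ _ (transOp_mem_hardySub hp hp' hf s)

theorem expB_mul_mem_mulHardySub (hp : 1 < p) (hp' : p ≠ ⊤) {l : ℝ} {f : LpR p}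
    (hf : f ∈ mulHardySub hp hp' l) {m : ℝ} (hm : 0 ≤ m) :
    mulOp (expB m) f ∈ mulHardySub hp hp' l := by
  rw [mem_mulHardySub] at hf ⊢
  rw [mulOp_comm_apply]
  exact expB_mul_mem_hardySub hp hp' hf hm

end Hardy

section Binest

variable {p : ℝ≥0∞} [Fact (1 ≤ p)]

/-- The half-line subspace `L^p[t,∞)` as a submodule. -/
def halfLineSub (t : ℝ) : Submodule ℂ (LpR p) :=
  (LpToLpRestrictCLM ℝ ℂ ℂ volume p (Set.Iio t)).ker

theorem mem_halfLineSub {t : ℝ} {f : LpR p} : f ∈ halfLineSub t ↔ f ∈ LpHalfLine p t := by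
  rw [halfLineSub, LinearMap.mem_ker, LpHalfLine, Set.mem_ofPred_eq]
  have h := LpToLpRestrictCLM_coeFn ℂ (Set.Iio t) f
  have hiff : (∀ᵐ x : ℝ, x < t → f x = 0) ↔ ∀ᵐ x ∂volume.restrict (Set.Iio t), f x = 0 :=
    (ae_restrict_iff' measurableSet_Iio).symm
  rw [hiff]
  constructor
  · intro h0
    have h1 := Lp.coeFn_zero ℂ p (volume.restrict (Set.Iio t))
    rw [← h0] at h1
    filter_upwards [h, h1] with x hx hx1
    rw [← hx]; exact hx1
  · intro h0
    refine Lp.ext ?_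
    filter_upwards [h, h0, Lp.coeFn_zero ℂ p (volume.restrict (Set.Iio t))] with x hx hx0 hx1
    rw [hx1]; exact hx.trans hx0

theorem isClosed_halfLineSub (t : ℝ) :
    IsClosed ((halfLineSub t : Submodule ℂ (LpR p)) : Set (LpR p)) :=
  (LpToLpRestrictCLM ℝ ℂ ℂ volume p (Set.Iio t)).isClosed_ker

theorem mulOp_mem_halfLineSub {t : ℝ} {f : LpR p} (hf : f ∈ halfLineSub t) (φ : ℝ →ᵇ ℂ) :
    mulOp φ f ∈ halfLineSub t := by
  rw [mem_halfLineSub] at hf ⊢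
  filter_upwards [hf, coeFn_mulOp φ f] with x hx h1 hxt
  rw [h1, hx hxt, mul_zero]

theorem transOp_mem_halfLineSub {t : ℝ} {f : LpR p} (hf : f ∈ halfLineSub t) {s : ℝ}
    (hs : 0 ≤ s) : transOp s f ∈ halfLineSub t := by
  rw [mem_halfLineSub] at hf ⊢
  have hq := (measurePreserving_sub_right (volume : Measure ℝ) s).quasiMeasurePreserving
  filter_upwards [hq.ae hf, coeFn_transOp s f] with x hx h1 hxt
  rw [h1, hx (by linarith)]

/-- The subspaces defining the Fourier binest algebra. -/
def binestFamily (hp : 1 < p) (hp' : p ≠ ⊤) : Set (Submodule ℂ (LpR p)) :=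
  Set.range halfLineSub ∪ Set.range (mulHardySub hp hp')

theorem isClosed_of_mem_binestFamily (hp : 1 < p) (hp' : p ≠ ⊤) {K : Submodule ℂ (LpR p)}
    (hK : K ∈ binestFamily hp hp') : IsClosed (K : Set (LpR p)) := by
  rcases hK with ⟨t, rfl⟩ | ⟨l, rfl⟩
  exacts [isClosed_halfLineSub t, isClosed_mulHardySub hp hp' l]

theorem coe_invAlg_binestFamily (hp : 1 < p) (hp' : p ≠ ⊤) :
    (invAlg (binestFamily hp hp') : Set (LpR p →L[ℂ] LpR p)) = fourierBinest p := by
  ext T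
  simp only [SetLike.mem_coe, mem_invAlg, binestFamily, Set.mem_union, or_imp, forall_and,
    Set.forall_mem_range, mem_halfLineSub, mem_mulHardySub_iff]
  rfl

theorem parabolicGens_subset_fourierBinest (hp : 1 < p) (hp' : p ≠ ⊤) :
    parabolicGens p ⊆ fourierBinest p := by
  rw [← coe_invAlg_binestFamily hp hp']
  rintro T (⟨l, hl, hT⟩ | ⟨s, hs, hT⟩)
  · obtain rfl := (eq_mulOp_iff (φ := expB l)).1 hT
    rintro K (⟨t, rfl⟩ | ⟨m, rfl⟩) f hf
    exacts [mulOp_mem_halfLineSub hf _, expB_mul_mem_mulHardySub hp hp' hf hl]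
  · obtain rfl := eq_transOp_iff.1 hT
    rintro K (⟨t, rfl⟩ | ⟨m, rfl⟩) f hf
    exacts [transOp_mem_halfLineSub hf hs, transOp_mem_mulHardySub hp hp' hf s]

theorem parabolicAlgebra_subset_fourierBinest (hp : 1 < p) (hp' : p ≠ ⊤) :
    parabolicAlgebra p ⊆ fourierBinest p := by
  refine Set.sInter_subset_of_mem ⟨parabolicGens_subset_fourierBinest hp hp', ?_,
    invAlg (binestFamily hp hp'), coe_invAlg_binestFamily hp hp'⟩
  rw [← coe_invAlg_binestFamily hp hp']
  exact isSOTClosed_invAlg fun K hK => isClosed_of_mem_binestFamily hp hp' hK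

/-- An algebra determined by closed invariant subspaces is reflexive. -/
theorem invAlg_eq_setOf_invariant {𝒦 : Set (Submodule ℂ (LpR p))}
    (h𝒦 : ∀ K ∈ 𝒦, IsClosed (K : Set (LpR p))) :
    (invAlg 𝒦 : Set (LpR p →L[ℂ] LpR p)) =
      {T | ∀ K : Submodule ℂ (LpR p), IsClosed (K : Set (LpR p)) →
        (∀ S ∈ (invAlg 𝒦 : Set (LpR p →L[ℂ] LpR p)), ∀ f ∈ K, S f ∈ K) →
          ∀ f ∈ K, T f ∈ K} := by
  ext T
  exact ⟨fun hT K _ hinv => hinv T hT,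
    fun hT K hK => hT K (h𝒦 K hK) fun S hS => hS K hK⟩

end Binest

section Summability

open scoped FourierTransform

/-- The Gaussian means of the Fourier inversion integral of `K`. -/
def gaussMean (K : ℝ → ℂ) (c x : ℝ) : ℂ :=
  ∫ w : ℝ, (Complex.exp (-(c⁻¹ : ℝ) * w ^ 2) * 𝓕 K w) * expB (2 * Real.pi * w) x

theorem integrable_gauss_mul_fourier {K : ℝ → ℂ} (hK : Integrable K) {c : ℝ} (hc : 0 < c) :
    Integrable fun w : ℝ => Complex.exp (-(c⁻¹ : ℝ) * w ^ 2) * 𝓕 K w := by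
  have hc' : 0 < c⁻¹ := inv_pos.2 hc
  refine Integrable.mul_bdd (c := ∫ v, ‖K v‖)
    (integrable_cexp_neg_mul_sq (b := ((c⁻¹ : ℝ) : ℂ)) (by rwa [Complex.ofReal_re]))
    (VectorFourier.fourierIntegral_continuous Real.continuous_fourierChar
      (L := innerₗ ℝ) (by fun_prop) hK).aestronglyMeasurable
    (Eventually.of_forall fun w => VectorFourier.norm_fourierIntegral_le_integral_norm _ _ _ _ _)

theorem gaussMean_eq {K : ℝ → ℂ} (hK : Integrable K) {c : ℝ} (hc : 0 < c) (x : ℝ) :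
    gaussMean K c x = ∫ w : ℝ, ((Real.pi * c) ^ (Module.finrank ℝ ℝ / 2 : ℂ) *
      Complex.exp (-Real.pi ^ 2 * c * ‖x - w‖ ^ 2)) • K w := by
  have hb : 0 < ((c⁻¹ : ℝ) : ℂ).re := by rw [Complex.ofReal_re]; exact inv_pos.2 hc
  have J : Integrable (fun w : ℝ => Complex.exp (-((c⁻¹ : ℝ) : ℂ) * ‖w‖ ^ 2 +
      2 * Real.pi * Complex.I * inner ℝ x w)) :=
    GaussianFourier.integrable_cexp_neg_mul_sq_norm_add hb _ _
  have h := VectorFourier.integral_fourierIntegral_smul_eq_flip (L := innerₗ ℝ)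
      Real.continuous_fourierChar continuous_inner J hK
  have h1 : gaussMean K c x = ∫ w : ℝ, Complex.exp (-((c⁻¹ : ℝ) : ℂ) * ‖w‖ ^ 2 +
      2 * Real.pi * Complex.I * inner ℝ x w) • 𝓕 K w := by
    refine integral_congr_ae (Eventually.of_forall fun w => ?_)
    simp only [smul_eq_mul, expB_apply, Complex.exp_add, Real.norm_eq_abs]
    have e1 : ((|w| : ℝ) : ℂ) ^ 2 = (w : ℂ) ^ 2 := by
      norm_cast; exact sq_abs w
    have e2 : 2 * (Real.pi : ℂ) * Complex.I * (inner ℝ x w : ℝ) =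
        Complex.I * (2 * Real.pi * w : ℝ) * x := by
      simp; ring
    rw [e1, e2]; ring
  rw [h1]
  rw [flip_innerₗ] at h
  refine h.symm.trans ?_
  refine integral_congr_ae (Eventually.of_forall fun w => ?_)
  have h2 := fourier_gaussian_innerProductSpace' hb x w
  have h3 : 𝓕 (fun v : ℝ => Complex.exp (-((c⁻¹ : ℝ) : ℂ) * ‖v‖ ^ 2 +
      2 * Real.pi * Complex.I * inner ℝ x v)) w =
      ((Real.pi * c) ^ (Module.finrank ℝ ℝ / 2 : ℂ) *
      Complex.exp (-Real.pi ^ 2 * c * ‖x - w‖ ^ 2)) := by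
    rw [h2]
    congr 2
    · push_cast; rw [div_inv_eq_mul]
    · push_cast; rw [div_inv_eq_mul]; ring
  exact congrArg (· • K w) h3

theorem norm_gaussMean_le (K : ℝ →ᵇ ℂ) (hK : Integrable K) {c : ℝ} (hc : 0 < c) (x : ℝ) :
    ‖gaussMean K c x‖ ≤ ‖K‖ := by
  rw [gaussMean_eq hK hc]
  have hg : ∀ w : ℝ, ‖((Real.pi * c : ℂ) ^ (Module.finrank ℝ ℝ / 2 : ℂ) *
      Complex.exp (-Real.pi ^ 2 * c * ‖x - w‖ ^ 2)) • K w‖ ≤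
      Real.sqrt (Real.pi * c) * Real.exp (-(Real.pi ^ 2 * c) * (x - w) ^ 2) * ‖K‖ := by
    intro w
    rw [norm_smul]
    gcongr
    · rw [norm_mul]
      refine le_of_eq ?_
      congr 1
      · rw [show (Real.pi * c : ℂ) = ((Real.pi * c : ℝ) : ℂ) by push_cast; ring,
          Complex.norm_cpow_eq_rpow_re_of_pos (by positivity), Real.sqrt_eq_rpow]
        simp
      · rw [Complex.norm_exp]
        congr 1
        have : -(Real.pi : ℂ) ^ 2 * c * (‖x - w‖ : ℝ) ^ 2 =
          ((-(Real.pi ^ 2 * c) * (x - w) ^ 2 : ℝ) : ℂ) := by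
          rw [Real.norm_eq_abs, ← Complex.ofReal_pow |x - w|, sq_abs]
          push_cast; ring
        rw [this, Complex.ofReal_re]
    · exact K.norm_coe_le_norm w
  have hb : 0 < Real.pi ^ 2 * c := by positivity
  have hi : Integrable fun w : ℝ =>
      Real.sqrt (Real.pi * c) * Real.exp (-(Real.pi ^ 2 * c) * (x - w) ^ 2) * ‖K‖ :=
    (((integrable_exp_neg_mul_sq hb).comp_sub_left x).const_mul _).mul_const _
  refine (norm_integral_le_of_norm_le hi (Eventually.of_forall hg)).trans (le_of_eq ?_)
  rw [integral_mul_const, integral_const_mul,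
    integral_sub_left_eq_self (fun w : ℝ => Real.exp (-(Real.pi ^ 2 * c) * w ^ 2)) volume x,
    integral_gaussian, ← Real.sqrt_mul (by positivity)]
  have : Real.pi * c * (Real.pi / (Real.pi ^ 2 * c)) = 1 := by
    have := Real.pi_pos.ne'
    field_simp
  rw [this, Real.sqrt_one, one_mul]

theorem continuous_gaussMean {K : ℝ → ℂ} (hK : Integrable K) {c : ℝ} (hc : 0 < c) :
    Continuous (gaussMean K c) := by
  have hi := integrable_gauss_mul_fourier hK hc
  refine continuous_of_dominated (fun x => ?_)
    (fun x => Eventually.of_forall fun w => ?_) hi.norm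
    (Eventually.of_forall fun w => continuous_const.mul (expB _).continuous)
  · refine hi.aestronglyMeasurable.mul (Continuous.aestronglyMeasurable ?_)
    simp only [expB_apply]; fun_prop
  · rw [norm_mul, norm_expB_apply, mul_one]

theorem tendsto_gaussMean (K : ℝ →ᵇ ℂ) (hK : Integrable K) (x : ℝ) :
    Tendsto (fun n : ℕ => gaussMean K (n + 1) x) atTop (𝓝 (K x)) := by
  have h1 := Real.tendsto_integral_gaussian_smul' hK (K.continuous.continuousAt (x := x))
  have h2 : Tendsto (fun n : ℕ => ((n : ℝ) + 1)) atTop atTop :=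
    tendsto_atTop_add_const_right _ _ tendsto_natCast_atTop_atTop
  refine (h1.comp h2).congr fun n => ?_
  rw [gaussMean_eq hK (by positivity)]
  rfl

variable {p : ℝ≥0∞} [Fact (1 ≤ p)]

/-- A bounded continuous integrable function whose Fourier transform is supported on
`[0,∞)` multiplies as an element of the algebra generated by the `M_λ`, `λ ≥ 0`. -/
theorem mulOp_mem_of_integral_eq_zero (hp' : p ≠ ⊤) {S : Subalgebra ℂ (LpR p →L[ℂ] LpR p)}
    (hS : IsSOTClosed p (S : Set (LpR p →L[ℂ] LpR p)))
    (hexp : ∀ l, 0 ≤ l → mulOp (expB l) ∈ S) (K : ℝ →ᵇ ℂ) (hK : Integrable K)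
    (h : ∀ l < 0, ∫ x, expB (-l) x * K x = 0) : mulOp K ∈ S := by
  have hn : ∀ n : ℕ, (0 : ℝ) < n + 1 := fun n => by positivity
  let G : ℕ → ℝ →ᵇ ℂ := fun n => BoundedContinuousFunction.ofNormedAddCommGroup
    (gaussMean K (n + 1)) (continuous_gaussMean hK (hn n)) ‖K‖ (norm_gaussMean_le K hK (hn n))
  refine hS.mem_of_tendsto (l := atTop) (A := fun n => mulOp (G n)) (fun n => ?_)
    (tendsto_mulOp hp' (C := ‖K‖)
      (fun n => BoundedContinuousFunction.norm_ofNormedAddCommGroup_le _ (norm_nonneg _) _)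
      (tendsto_gaussMean K hK))
  have hi := integrable_gauss_mul_fourier hK (hn n)
  let A : ℝ → LpR p →L[ℂ] LpR p := fun w =>
    (Complex.exp (-(((n : ℝ) + 1)⁻¹ : ℝ) * w ^ 2) * 𝓕 (K : ℝ → ℂ) w) •
      mulOp (expB (2 * Real.pi * w))
  have hA : ∀ w, ‖A w‖ ≤ ‖Complex.exp (-(((n : ℝ) + 1)⁻¹ : ℝ) * w ^ 2) * 𝓕 (K : ℝ → ℂ) w‖ :=
    fun w => by
      rw [norm_smul]
      exact mul_le_of_le_one_right (norm_nonneg _) ((norm_mulOp_le _).trans (norm_expB_le _))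
  have hm : ∀ f, AEStronglyMeasurable (fun t => A t f) volume := fun f =>
    hi.aestronglyMeasurable.smul (Continuous.mulOp_apply hp' (C := 1) (fun _ => norm_expB_le _)
      (fun x => by simp only [expB_apply]; fun_prop) continuous_const).aestronglyMeasurable
  have hmem : ∀ w, A w ∈ S := by
    intro w
    rcases le_or_gt 0 w with hw | hw
    · exact S.smul_mem (hexp _ (by positivity)) _
    · have h0 : 𝓕 (K : ℝ → ℂ) w = 0 := by
        rw [Real.fourier_real_eq_integral_exp_smul,
          ← h (2 * Real.pi * w) (mul_neg_of_pos_of_neg (by positivity) hw)]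
        refine integral_congr_ae (Eventually.of_forall fun v => ?_)
        simp only [expB_apply, smul_eq_mul]
        congr 2
        push_cast; ring
      simp only [A, h0, mul_zero, zero_smul]
      exact S.zero_mem
  have hint := hS.intOp_mem hi.norm hA hm hmem
  have heq : mulOp (G n) = intOp A _ hi.norm hA hm := by
    ext1 f
    refine Lp.ext ?_
    have h1 := coeFn_integral_Lp (integrable_apply_of_norm_le hi.norm hA hm f)
      (g := fun z => (Complex.exp (-(((n : ℝ) + 1)⁻¹ : ℝ) * z.1 ^ 2) * 𝓕 (K : ℝ → ℂ) z.1) *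
        (expB (2 * Real.pi * z.1) z.2 * f z.2))
      (hi.aestronglyMeasurable.comp_fst.mul
        ((Continuous.aestronglyMeasurable (by simp only [expB_apply]; fun_prop)).mul
          (Lp.aestronglyMeasurable f).comp_snd))
      (Eventually.of_forall fun w => by
        filter_upwards [Lp.coeFn_smul (Complex.exp (-(((n : ℝ) + 1)⁻¹ : ℝ) * w ^ 2) *
          𝓕 (K : ℝ → ℂ) w) (mulOp (expB (2 * Real.pi * w)) f),
          coeFn_mulOp (expB (2 * Real.pi * w)) f] with x hx1 hx2
        refine hx1.trans ?_
        rw [Pi.smul_apply, hx2, smul_eq_mul])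
    rw [intOp_apply]
    filter_upwards [coeFn_mulOp (G n) f, h1] with x hx1 hx2
    rw [hx1, hx2]
    simp_rw [← mul_assoc]
    rw [integral_mul_const]
    rfl
  rw [heq]
  exact hint

end Summability

section Smoothing

theorem one_add_sub_sq_inv_le (x y : ℝ) :
    (1 + x ^ 2)⁻¹ * (1 + y ^ 2)⁻¹ ≤ 2 * (1 + (x - y) ^ 2)⁻¹ := by
  rw [← mul_inv, ← div_eq_mul_inv, ← one_div, div_le_div_iff₀ (by positivity) (by positivity)]
  nlinarith [sq_nonneg (x + y), mul_nonneg (sq_nonneg x) (sq_nonneg y)]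

theorem one_add_sq_inv_le_mul (x y : ℝ) :
    (1 + x ^ 2)⁻¹ ≤ 2 * (1 + (x - y) ^ 2) * (1 + y ^ 2)⁻¹ := by
  rw [← div_eq_mul_inv, ← one_div, div_le_div_iff₀ (by positivity) (by positivity)]
  nlinarith [sq_nonneg (2 * x - y), mul_nonneg (sq_nonneg x) (sq_nonneg (x - y))]

theorem one_add_sq_inv_le_inv (x : ℝ) : (1 + x ^ 2)⁻¹ ≤ 2 * (1 + |x|)⁻¹ := by
  rw [← div_eq_mul_inv, ← one_div, div_le_div_iff₀ (by positivity) (by positivity)]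
  nlinarith [sq_nonneg (|x| - 1), sq_abs x]

theorem memLp_of_norm_le_one_add_sq_inv {r : ℝ≥0∞} (hr : 1 < r) (hr' : r ≠ ⊤) {g : ℝ → ℂ}
    (hg : AEStronglyMeasurable g volume) {C : ℝ} (hC : 0 ≤ C)
    (h : ∀ x, ‖g x‖ ≤ C * (1 + x ^ 2)⁻¹) : MemLp g r volume :=
  memLp_of_norm_le_inv hr hr' hg (C := C * 2) fun x => by
    rw [mul_assoc]
    exact (h x).trans (mul_le_mul_of_nonneg_left (one_add_sq_inv_le_inv x) hC)

/-- A continuous complex function supported in `[0,1]`. -/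
structure Mollifier where
  /-- the underlying function -/
  toFun : ℝ → ℂ
  continuous : Continuous toFun
  eq_zero : ∀ x, x ∉ Set.Icc (0 : ℝ) 1 → toFun x = 0

namespace Mollifier

instance : CoeFun Mollifier fun _ => ℝ → ℂ := ⟨Mollifier.toFun⟩

variable (φ : Mollifier)

theorem hasCompactSupport : HasCompactSupport φ :=
  HasCompactSupport.intro isCompact_Icc φ.eq_zero

theorem integrable : Integrable φ :=
  φ.continuous.integrable_of_hasCompactSupport φ.hasCompactSupport

theorem memLp (r : ℝ≥0∞) : MemLp φ r volume :=
  φ.continuous.memLp_of_hasCompactSupport φ.hasCompactSupport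

theorem memLp_neg (r : ℝ≥0∞) : MemLp (fun z => φ (-z)) r volume :=
  (φ.memLp r).comp_measurePreserving (Measure.measurePreserving_neg volume)

variable {p : ℝ≥0∞} [Fact (1 ≤ p)]

/-- The functional `f ↦ (φ ∗ f)(x)`. -/
def evalConv (x : ℝ) : LpR p →L[ℂ] ℂ :=
  (pairing _ (φ.memLp_neg p.conjExponent)).comp (transOp (-x))

theorem evalConv_apply (x : ℝ) (f : LpR p) : φ.evalConv x f = ∫ z, φ (x - z) * f z := by
  rw [evalConv, ContinuousLinearMap.comp_apply, pairing_apply,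
    ← integral_add_right_eq_self (fun z => φ (x - z) * f z) x]
  refine integral_congr_ae ?_
  filter_upwards [coeFn_transOp (-x) f] with z hz
  rw [hz, sub_neg_eq_add]
  congr 2
  ring

theorem exists_norm_evalConv_le :
    ∃ C, 0 ≤ C ∧ ∀ (x : ℝ) (f : LpR p), ‖φ.evalConv x f‖ ≤ C * ‖f‖ := by
  refine ⟨_, norm_nonneg (pairing (p := p) _ (φ.memLp_neg p.conjExponent)), fun x f => ?_⟩
  refine (ContinuousLinearMap.le_opNorm (pairing _ (φ.memLp_neg p.conjExponent)) _).trans_eq ?_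
  exact congrArg _ (norm_transOp (-x) f)

theorem continuous_evalConv (hp' : p ≠ ⊤) {X : Type*} [TopologicalSpace X] {s : X → ℝ}
    {f : X → LpR p} (hs : Continuous s) (hf : Continuous f) :
    Continuous fun z => φ.evalConv (s z) (f z) :=
  (pairing _ (φ.memLp_neg p.conjExponent)).continuous.comp
    (Continuous.transOp_apply hp' hs.neg hf)

theorem aestronglyMeasurable_smul_transOp (hp' : p ≠ ⊤) (f : LpR p) :
    AEStronglyMeasurable (fun s => (φ s • transOp s : LpR p →L[ℂ] LpR p) f) volume :=
  (φ.continuous.smul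
    (Continuous.transOp_apply hp' continuous_id continuous_const)).aestronglyMeasurable

theorem norm_smul_transOp_le (s : ℝ) :
    ‖(φ s • transOp s : LpR p →L[ℂ] LpR p)‖ ≤ ‖φ s‖ := by
  rw [norm_smul]
  exact mul_le_of_le_one_right (norm_nonneg _) (norm_transOp_le s)

/-- The convolution operator `f ↦ φ ∗ f`. -/
def convOp (hp' : p ≠ ⊤) : LpR p →L[ℂ] LpR p :=
  intOp (fun s => φ s • transOp s) (fun s => ‖φ s‖) φ.integrable.norm φ.norm_smul_transOp_le
    (φ.aestronglyMeasurable_smul_transOp hp')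

theorem convOp_apply (hp' : p ≠ ⊤) (f : LpR p) :
    φ.convOp hp' f = ∫ s, φ s • transOp s f := rfl

theorem coeFn_convOp (hp' : p ≠ ⊤) (f : LpR p) :
    (φ.convOp hp' f : ℝ → ℂ) =ᵐ[volume] fun x => φ.evalConv x f := by
  have h := coeFn_integral_Lp (integrable_apply_of_norm_le φ.integrable.norm
    φ.norm_smul_transOp_le (φ.aestronglyMeasurable_smul_transOp hp') f)
    (g := fun z => φ z.1 * f (z.2 - z.1))
    ((φ.continuous.comp continuous_fst).aestronglyMeasurable.mul
      ((Lp.stronglyMeasurable f).comp_measurable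
        (measurable_snd.sub measurable_fst)).aestronglyMeasurable)
    (Eventually.of_forall fun s => by
      filter_upwards [Lp.coeFn_smul (φ s) (transOp s f), coeFn_transOp s f] with x h1 h2
      refine h1.trans ?_
      rw [Pi.smul_apply, h2, smul_eq_mul])
  filter_upwards [h] with x hx
  refine hx.trans ?_
  rw [evalConv_apply, ← integral_sub_left_eq_self _ volume x]
  simp only [sub_sub_cancel]

theorem norm_convOp_apply_le (hp' : p ≠ ⊤) (f : LpR p) :
    ‖φ.convOp hp' f‖ ≤ (∫ s, ‖φ s‖) * ‖f‖ := by
  rw [convOp_apply, ← integral_mul_const]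
  refine norm_integral_le_of_norm_le (φ.integrable.norm.mul_const _)
    (Eventually.of_forall fun s => ?_)
  rw [norm_smul, norm_transOp]

theorem convOp_mem (hp' : p ≠ ⊤) {S : Subalgebra ℂ (LpR p →L[ℂ] LpR p)}
    (hS : IsSOTClosed p (S : Set (LpR p →L[ℂ] LpR p)))
    (htrans : ∀ s, 0 ≤ s → transOp s ∈ S) : φ.convOp hp' ∈ S := by
  refine hS.intOp_mem _ _ _ fun s => ?_
  rcases le_or_gt 0 s with hs | hs
  · exact S.smul_mem (htrans s hs) _
  · rw [φ.eq_zero s (fun h => hs.not_ge h.1), zero_smul]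
    exact S.zero_mem

variable (h : ℝ →ᵇ ℂ)

/-- The function `x ↦ h(x) φ(x - y)` as an element of `L^p(ℝ)`. -/
def window (p : ℝ≥0∞) [Fact (1 ≤ p)] (y : ℝ) : LpR p :=
  mulOp h (transOp y ((φ.memLp p).toLp φ))

theorem coeFn_window (y : ℝ) :
    (φ.window h p y : ℝ → ℂ) =ᵐ[volume] fun x => h x * φ (x - y) := by
  have hq := (measurePreserving_sub_right (volume : Measure ℝ) y).quasiMeasurePreserving
  filter_upwards [coeFn_mulOp h (transOp y ((φ.memLp p).toLp φ)),
    coeFn_transOp y ((φ.memLp p).toLp φ), hq.ae (φ.memLp p).coeFn_toLp] with x h1 h2 h3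
  rw [window, h1, h2, h3]

theorem continuous_window (hp' : p ≠ ⊤) : Continuous (φ.window h p) :=
  (mulOp h).continuous.comp (Continuous.transOp_apply hp' continuous_id continuous_const)

theorem window_mem_halfLineSub (y : ℝ) : φ.window h p y ∈ halfLineSub y := by
  rw [mem_halfLineSub]
  filter_upwards [φ.coeFn_window (p := p) h y] with x hx hxy
  rw [hx, φ.eq_zero _ (fun h => by linarith [h.1]), mul_zero]

theorem evalConv_eq_zero {x y : ℝ} (hxy : x < y) {f : LpR p} (hf : f ∈ halfLineSub y) :
    φ.evalConv x f = 0 := by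
  rw [evalConv_apply]
  refine integral_eq_zero_of_ae ?_
  rw [mem_halfLineSub] at hf
  filter_upwards [hf] with z hz
  rcases lt_or_ge z y with hzy | hzy
  · rw [hz hzy, mul_zero]; rfl
  · rw [φ.eq_zero _ (fun h => by linarith [h.1]), zero_mul]; rfl

variable {h} {C : ℝ}

theorem exists_norm_window_le (hC : 0 ≤ C) (hh : ∀ x, ‖h x‖ ≤ C * (1 + x ^ 2)⁻¹) :
    ∃ C', 0 ≤ C' ∧ ∀ y, ‖φ.window h p y‖ ≤ C' * (1 + y ^ 2)⁻¹ := by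
  refine ⟨C * 4 * ‖(φ.memLp p).toLp φ‖, by positivity, fun y => ?_⟩
  rw [mul_right_comm, ← norm_transOp y ((φ.memLp p).toLp φ)]
  refine Lp.norm_le_mul_norm_of_ae_le_mul ?_
  have hq := (measurePreserving_sub_right (volume : Measure ℝ) y).quasiMeasurePreserving
  filter_upwards [φ.coeFn_window (p := p) h y, coeFn_transOp y ((φ.memLp p).toLp φ),
    hq.ae (φ.memLp p).coeFn_toLp] with x h1 h2 h3
  rw [h1, h2, h3, norm_mul]
  by_cases hx : x - y ∈ Set.Icc (0 : ℝ) 1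
  · refine mul_le_mul_of_nonneg_right ((hh x).trans ?_) (norm_nonneg _)
    rw [mul_assoc]
    refine mul_le_mul_of_nonneg_left ((one_add_sq_inv_le_mul x y).trans ?_) hC
    refine mul_le_mul_of_nonneg_right ?_ (by positivity)
    nlinarith [hx.1, hx.2]
  · rw [φ.eq_zero _ hx, norm_zero, mul_zero, mul_zero]

theorem integrable_smul_window (hp : 1 < p) (hp' : p ≠ ⊤) (hC : 0 ≤ C)
    (hh : ∀ x, ‖h x‖ ≤ C * (1 + x ^ 2)⁻¹) (f : LpR p) :
    Integrable fun y => f y • φ.window h p y := by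
  obtain ⟨C', hC', hw⟩ := φ.exists_norm_window_le (p := p) hC hh
  have h1 : MemLp (fun y : ℝ => ((C' * (1 + y ^ 2)⁻¹ : ℝ) : ℂ)) p.conjExponent volume := by
    refine memLp_of_norm_le_one_add_sq_inv (one_lt_conjExponent hp') (conjExponent_ne_top hp)
      ?_ hC' fun x => ?_
    · exact (Complex.continuous_ofReal.comp (continuous_const.mul (Continuous.inv₀ (by fun_prop)
        fun x => by positivity))).aestronglyMeasurable
    · rw [Complex.norm_real, Real.norm_of_nonneg (by positivity)]
  refine ((Lp.memLp f).integrable_mul h1).norm.mono'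
    ((Lp.aestronglyMeasurable f).smul (φ.continuous_window h hp').aestronglyMeasurable)
    (Eventually.of_forall fun y => ?_)
  rw [norm_smul, Pi.mul_apply, norm_mul, Complex.norm_real, Real.norm_of_nonneg (by positivity)]
  exact mul_le_mul_of_nonneg_left (hw y) (norm_nonneg _)

theorem mulOp_convOp_eq_integral (hp : 1 < p) (hp' : p ≠ ⊤) (hC : 0 ≤ C)
    (hh : ∀ x, ‖h x‖ ≤ C * (1 + x ^ 2)⁻¹) (f : LpR p) :
    mulOp h (φ.convOp hp' f) = ∫ y, f y • φ.window h p y := by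
  refine Lp.ext ?_
  have h1 := coeFn_integral_Lp (φ.integrable_smul_window hp hp' hC hh f)
    (g := fun z => f z.1 * (h z.2 * φ (z.2 - z.1)))
    ((Lp.aestronglyMeasurable f).comp_fst.mul
      (Continuous.aestronglyMeasurable ((h.continuous.comp continuous_snd).mul
        (φ.continuous.comp (continuous_snd.sub continuous_fst)))))
    (Eventually.of_forall fun y => by
      filter_upwards [Lp.coeFn_smul (f y) (φ.window h p y),
        φ.coeFn_window (p := p) h y] with x h1 h2
      refine h1.trans ?_
      rw [Pi.smul_apply, h2, smul_eq_mul])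
  filter_upwards [h1, coeFn_mulOp h (φ.convOp hp' f), φ.coeFn_convOp hp' f] with x h2 h3 h4
  rw [h3, h4, h2, evalConv_apply, ← integral_const_mul]
  refine integral_congr_ae (Eventually.of_forall fun y => ?_)
  ring

variable (h)

/-- The integral kernel of `M_h P T M_h P`, where `P` is convolution with `φ`. -/
def kernel (T : LpR p →L[ℂ] LpR p) (x y : ℝ) : ℂ :=
  h x * φ.evalConv x (T (φ.window h p y))

theorem continuous_kernel (hp' : p ≠ ⊤) (T : LpR p →L[ℂ] LpR p) :
    Continuous fun z : ℝ × ℝ => φ.kernel h T z.1 z.2 :=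
  (h.continuous.comp continuous_fst).mul (φ.continuous_evalConv hp' continuous_fst
    (T.continuous.comp ((φ.continuous_window h hp').comp continuous_snd)))

theorem kernel_eq_zero {T : LpR p →L[ℂ] LpR p} (hT : T ∈ fourierBinest p) {x y : ℝ}
    (hxy : x < y) : φ.kernel h T x y = 0 := by
  have h1 : T (φ.window h p y) ∈ halfLineSub y :=
    mem_halfLineSub.2 (hT.1 y _ (mem_halfLineSub.1 (φ.window_mem_halfLineSub h y)))
  rw [kernel, φ.evalConv_eq_zero hxy h1, mul_zero]

variable {h}

theorem exists_norm_kernel_le (hC : 0 ≤ C) (hh : ∀ x, ‖h x‖ ≤ C * (1 + x ^ 2)⁻¹)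
    (T : LpR p →L[ℂ] LpR p) :
    ∃ B, 0 ≤ B ∧ ∀ x y, ‖φ.kernel h T x y‖ ≤ B * ((1 + x ^ 2)⁻¹ * (1 + y ^ 2)⁻¹) := by
  obtain ⟨C', hC', hw⟩ := φ.exists_norm_window_le (p := p) hC hh
  obtain ⟨D, hD, he⟩ := φ.exists_norm_evalConv_le (p := p)
  refine ⟨C * (D * (‖T‖ * C')), by positivity, fun x y => ?_⟩
  calc ‖φ.kernel h T x y‖ = ‖h x‖ * ‖φ.evalConv x (T (φ.window h p y))‖ := norm_mul _ _
    _ ≤ (C * (1 + x ^ 2)⁻¹) * (D * (‖T‖ * (C' * (1 + y ^ 2)⁻¹))) := by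
        gcongr
        · exact hh x
        · refine (he x _).trans ?_
          gcongr
          refine (T.le_opNorm _).trans ?_
          gcongr
          exact hw y
    _ = _ := by ring

theorem coeFn_compress (hp : 1 < p) (hp' : p ≠ ⊤) (hC : 0 ≤ C)
    (hh : ∀ x, ‖h x‖ ≤ C * (1 + x ^ 2)⁻¹) (T : LpR p →L[ℂ] LpR p) (f : LpR p) :
    (mulOp h (φ.convOp hp' (T (mulOp h (φ.convOp hp' f)))) : ℝ → ℂ) =ᵐ[volume]
      fun x => ∫ t, φ.kernel h T x (x - t) * f (x - t) := by
  filter_upwards [coeFn_mulOp h (φ.convOp hp' (T (mulOp h (φ.convOp hp' f)))),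
    φ.coeFn_convOp hp' (T (mulOp h (φ.convOp hp' f)))] with x h1 h2
  have hi := φ.integrable_smul_window hp hp' hC hh f
  have h3 := ((φ.evalConv x).comp T).integral_comp_comm hi
  rw [h1, h2, φ.mulOp_convOp_eq_integral hp hp' hC hh,
    integral_sub_left_eq_self (fun t => φ.kernel h T x t * f t) volume x]
  refine (congrArg (h x * ·) h3.symm).trans ?_
  rw [← integral_const_mul]
  refine integral_congr_ae (Eventually.of_forall fun y => ?_)
  simp only [map_smul, ContinuousLinearMap.comp_apply, smul_eq_mul, kernel]
  ring

end Mollifier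

end Smoothing

section Compression

open scoped FourierTransform

theorem Continuous.eq_zero_of_forall_integral_expB_mul_eq_zero {c : ℝ → ℂ} (hc : Continuous c)
    (hi : Integrable c) (h : ∀ η, ∫ t, expB η t * c t = 0) : c = 0 := by
  have h0 : 𝓕 c = 0 := by
    ext w
    rw [Real.fourier_real_eq_integral_exp_smul, Pi.zero_apply, ← h (-(2 * Real.pi * w))]
    refine integral_congr_ae (Eventually.of_forall fun v => ?_)
    simp only [expB_apply, smul_eq_mul]
    congr 2
    push_cast; ring
  rw [← hc.fourierInv_fourier_eq hi (by rw [h0]; exact integrable_zero _ _ _), h0]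
  ext x
  rw [Real.fourierInv_eq]
  simp

theorem norm_resB_sq_le {a : ℝ} (ha : 0 < a) (x : ℝ) :
    ‖(resB a ^ 2) x‖ ≤ (1 + (a ^ 2)⁻¹) * (1 + x ^ 2)⁻¹ := by
  have h1 : ‖1 - Complex.I * a * x‖ ^ 2 = 1 + a ^ 2 * x ^ 2 := by
    rw [← Complex.normSq_eq_norm_sq, Complex.normSq_apply]
    simp; ring
  rw [BoundedContinuousFunction.pow_apply, resB_apply, norm_pow, norm_inv, inv_pow, h1,
    ← div_eq_mul_inv, ← one_div, div_le_div_iff₀ (by positivity) (by positivity)]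
  have : (1 + (a ^ 2)⁻¹) * (1 + a ^ 2 * x ^ 2) = 1 + x ^ 2 + ((a ^ 2)⁻¹ + a ^ 2 * x ^ 2) := by
    field_simp; ring
  rw [this, one_mul]
  exact le_add_of_nonneg_right (by positivity)

namespace Mollifier

variable (φ : Mollifier) {p : ℝ≥0∞} [Fact (1 ≤ p)] {h : ℝ →ᵇ ℂ} {C : ℝ}

theorem integrable_expB_smul_window (hp' : p ≠ ⊤) (hC : 0 ≤ C)
    (hh : ∀ x, ‖h x‖ ≤ C * (1 + x ^ 2)⁻¹) (η : ℝ) :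
    Integrable fun y => expB η y • φ.window h p y := by
  obtain ⟨C', hC', hw⟩ := φ.exists_norm_window_le (p := p) hC hh
  refine (integrable_inv_one_add_sq.const_mul C').mono'
    ((expB η).continuous.smul (φ.continuous_window h hp')).aestronglyMeasurable
    (Eventually.of_forall fun y => ?_)
  rw [norm_smul, norm_expB_apply, one_mul]
  exact hw y

theorem integral_expB_smul_window (hp' : p ≠ ⊤) (hC : 0 ≤ C)
    (hh : ∀ x, ‖h x‖ ≤ C * (1 + x ^ 2)⁻¹) (η : ℝ) {f : LpR p} (hf : f =ᵐ[volume] h) :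
    ∫ y, expB η y • φ.window h p y = (∫ s, expB (-η) s * φ s) • mulOp (expB η) f := by
  refine Lp.ext ?_
  have h1 := coeFn_integral_Lp (φ.integrable_expB_smul_window (p := p) hp' hC hh η)
    (g := fun z => expB η z.1 * (h z.2 * φ (z.2 - z.1)))
    (Continuous.aestronglyMeasurable (((expB η).continuous.comp continuous_fst).mul
      ((h.continuous.comp continuous_snd).mul
        (φ.continuous.comp (continuous_snd.sub continuous_fst)))))
    (Eventually.of_forall fun y => by
      filter_upwards [Lp.coeFn_smul (expB η y) (φ.window h p y),
        φ.coeFn_window (p := p) h y] with x h1 h2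
      refine h1.trans ?_
      rw [Pi.smul_apply, h2, smul_eq_mul])
  filter_upwards [h1, coeFn_mulOp (expB η) f, hf,
    Lp.coeFn_smul (∫ s, expB (-η) s * φ s) (mulOp (expB η) f)] with x h2 h3 h4 h5
  rw [h2, h5, Pi.smul_apply, h3, h4, smul_eq_mul, ← integral_mul_const,
    ← integral_sub_left_eq_self _ volume x]
  refine integral_congr_ae (Eventually.of_forall fun s => ?_)
  simp only [expB_apply_sub, sub_sub_cancel]
  have : expB η (-s) = expB (-η) s := by
    simp only [expB_apply]; congr 1; push_cast; ring
  rw [this]; ring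

theorem convOp_mem_mulHardySub (hp : 1 < p) (hp' : p ≠ ⊤) {l : ℝ} {f : LpR p}
    (hf : f ∈ mulHardySub hp hp' l) : φ.convOp hp' f ∈ mulHardySub hp hp' l :=
  φ.convOp_mem hp' (S := invAlg {mulHardySub hp hp' l})
    (isSOTClosed_invAlg fun K hK => by
      rw [Set.mem_singleton_iff.1 hK]; exact isClosed_mulHardySub hp hp' l)
    (fun s _ => by
      rintro K rfl f hf
      exact transOp_mem_mulHardySub hp hp' hf s) _ rfl _ hf

theorem integral_kernel_eq_zero (hp : 1 < p) (hp' : p ≠ ⊤) {T : LpR p →L[ℂ] LpR p}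
    (hT : T ∈ fourierBinest p) {a : ℝ} (ha : 0 < a) {l : ℝ} (hl : l < 0) (η : ℝ) :
    ∫ x, expB (-l) x * ∫ y, expB (-η) (x - y) * φ.kernel (resB a ^ 2) T x y = 0 := by
  have hC : 0 ≤ 1 + (a ^ 2)⁻¹ := by positivity
  have hh := norm_resB_sq_le ha
  set f : LpR p := (memLp_resB hp hp' ha).toLp _ with hf
  have hfa : f =ᵐ[volume] resB a := (memLp_resB hp hp' ha).coeFn_toLp
  have hg : mulOp (resB a) f =ᵐ[volume] ⇑(resB a ^ 2) := by
    filter_upwards [coeFn_mulOp (resB a) f, hfa] with x h1 h2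
    rw [h1, h2, sq, BoundedContinuousFunction.mul_apply]
  set E : LpR p := ∫ y, expB η y • φ.window (resB a ^ 2) p y with hE
  have hEm : E ∈ mulHardySub hp hp' η := by
    rw [hE, φ.integral_expB_smul_window hp' hC hh η hg]
    refine Submodule.smul_mem _ _ ?_
    rw [mem_mulHardySub, mulOp_comp, expB_mul, neg_add_cancel, expB_zero, mulOp_one]
    exact resB_mul_mem_hardySub hp hp' (toLp_resB_mem_hardySub hp hp' ha) ha.le
  have hTE : T E ∈ mulHardySub hp hp' η :=
    (mem_mulHardySub_iff hp hp').2 (hT.2 η _ ((mem_mulHardySub_iff hp hp').1 hEm))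
  have hv := (mem_mulHardySub hp hp').1 (φ.convOp_mem_mulHardySub hp hp' hTE)
  have h0 := integral_resB_mul_eq_zero hp hp' (resB_mul_mem_hardySub hp hp'
    (expB_mul_mem_hardySub hp hp' hv (neg_nonneg.2 hl.le)) ha.le) ha
  rw [← h0]
  refine integral_congr_ae ?_
  set v := mulOp (expB (-η)) (φ.convOp hp' (T E))
  filter_upwards [coeFn_mulOp (resB a) (mulOp (expB (-l)) v), coeFn_mulOp (expB (-l)) v,
    coeFn_mulOp (expB (-η)) (φ.convOp hp' (T E)), φ.coeFn_convOp hp' (T E)] with x h1 h2 h3 h4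
  rw [h1, h2, h3, h4]
  have h5 := ((φ.evalConv x).comp T).integral_comp_comm
    (φ.integrable_expB_smul_window hp' hC hh η)
  have h6 : ∫ y, expB (-η) (x - y) * φ.kernel (resB a ^ 2) T x y =
      expB (-η) x * ((resB a ^ 2) x * φ.evalConv x (T E)) := by
    refine Eq.trans ?_ (congrArg (fun z => expB (-η) x * ((resB a ^ 2) x * z)) h5)
    rw [← integral_const_mul, ← integral_const_mul]
    refine integral_congr_ae (Eventually.of_forall fun y => ?_)
    have : expB (-η) (-y) = expB η y := by
      simp only [expB_apply]; congr 1; push_cast; ring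
    simp only [map_smul, ContinuousLinearMap.comp_apply, smul_eq_mul, kernel, expB_apply_sub, this]
    ring
  rw [h6, sq, BoundedContinuousFunction.mul_apply]
  ring

theorem integrable_one_add_sq_inv_mul_sub :
    Integrable (fun z : ℝ × ℝ => (1 + z.2 ^ 2)⁻¹ * (1 + (z.2 - z.1) ^ 2)⁻¹)
      (volume.prod volume) := by
  refine (integrable_inv_one_add_sq.convolution_integrand (ContinuousLinearMap.mul ℝ ℝ)
    integrable_inv_one_add_sq).congr (Eventually.of_forall fun z => ?_)
  simp only [ContinuousLinearMap.mul_apply']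
  rw [sub_sq_comm]

theorem continuous_kernel_slice (hp' : p ≠ ⊤) (h : ℝ →ᵇ ℂ) (T : LpR p →L[ℂ] LpR p) :
    Continuous fun z : ℝ × ℝ => φ.kernel h T z.2 (z.2 - z.1) :=
  (φ.continuous_kernel h hp' T).comp
    (continuous_snd.prodMk (continuous_snd.sub continuous_fst))

theorem integral_kernel_slice_eq_zero (hp : 1 < p) (hp' : p ≠ ⊤) {T : LpR p →L[ℂ] LpR p}
    (hT : T ∈ fourierBinest p) {a : ℝ} (ha : 0 < a) {l : ℝ} (hl : l < 0) (t : ℝ) :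
    ∫ x, expB (-l) x * φ.kernel (resB a ^ 2) T x (x - t) = 0 := by
  obtain ⟨B, hB, hk⟩ := φ.exists_norm_kernel_le (by positivity) (norm_resB_sq_le ha) T
  have hcont' : Continuous fun z : ℝ × ℝ =>
      expB (-l) z.2 * φ.kernel (resB a ^ 2) T z.2 (z.2 - z.1) :=
    ((expB _).continuous.comp continuous_snd).mul (φ.continuous_kernel_slice hp' _ T)
  have hbound : ∀ z : ℝ × ℝ, ‖expB (-l) z.2 * φ.kernel (resB a ^ 2) T z.2 (z.2 - z.1)‖ ≤
      B * ((1 + z.2 ^ 2)⁻¹ * (1 + (z.2 - z.1) ^ 2)⁻¹) := fun z => by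
    rw [norm_mul, norm_expB_apply, one_mul]; exact hk _ _
  have hint : Integrable (fun z : ℝ × ℝ =>
      expB (-l) z.2 * φ.kernel (resB a ^ 2) T z.2 (z.2 - z.1)) (volume.prod volume) :=
    (integrable_one_add_sq_inv_mul_sub.const_mul B).mono' hcont'.aestronglyMeasurable
      (Eventually.of_forall hbound)
  have hc : Continuous fun t => ∫ x, expB (-l) x * φ.kernel (resB a ^ 2) T x (x - t) := by
    refine continuous_of_dominated (bound := fun x => B * (1 + x ^ 2)⁻¹)
      (fun t => (hcont'.comp (Continuous.prodMk_right t)).aestronglyMeasurable)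
      (fun t => Eventually.of_forall fun x => (hbound (t, x)).trans ?_)
      (integrable_inv_one_add_sq.const_mul B)
      (Eventually.of_forall fun x => hcont'.comp (Continuous.prodMk_left x))
    refine mul_le_mul_of_nonneg_left (mul_le_of_le_one_right (by positivity) ?_) hB
    exact inv_le_one_of_one_le₀ (le_add_of_nonneg_right (sq_nonneg _))
  refine congrFun (hc.eq_zero_of_forall_integral_expB_mul_eq_zero hint.integral_prod_left
    fun η => ?_) t
  have hint2 : Integrable (Function.uncurry fun t x =>
      expB η t * (expB (-l) x * φ.kernel (resB a ^ 2) T x (x - t))) (volume.prod volume) :=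
    hint.bdd_mul (c := 1) ((expB η).continuous.comp continuous_fst).aestronglyMeasurable
      (Eventually.of_forall fun z => (norm_expB_apply η z.1).le)
  simp_rw [← integral_const_mul]
  rw [integral_integral_swap hint2, ← φ.integral_kernel_eq_zero hp hp' hT ha hl (-η)]
  refine integral_congr_ae (Eventually.of_forall fun x => ?_)
  simp only [neg_neg]
  rw [← integral_const_mul, ← integral_sub_left_eq_self _ volume x]
  refine integral_congr_ae (Eventually.of_forall fun y => ?_)
  simp only [sub_sub_cancel]
  ring

theorem norm_kernel_slice_le {B : ℝ} (hB : 0 ≤ B) {T : LpR p →L[ℂ] LpR p}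
    (hk : ∀ x y, ‖φ.kernel h T x y‖ ≤ B * ((1 + x ^ 2)⁻¹ * (1 + y ^ 2)⁻¹)) (t x : ℝ) :
    ‖φ.kernel h T x (x - t)‖ ≤ B * (2 * (1 + t ^ 2)⁻¹) := by
  refine (hk _ _).trans (mul_le_mul_of_nonneg_left ?_ hB)
  simpa using one_add_sub_sq_inv_le x (x - t)

/-- The values of the kernel along a line parallel to the diagonal. -/
def slice (hp' : p ≠ ⊤) {T : LpR p →L[ℂ] LpR p} {B : ℝ} (hB : 0 ≤ B)
    (hk : ∀ x y, ‖φ.kernel h T x y‖ ≤ B * ((1 + x ^ 2)⁻¹ * (1 + y ^ 2)⁻¹)) (t : ℝ) : ℝ →ᵇ ℂ :=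
  BoundedContinuousFunction.ofNormedAddCommGroup
    (fun x => φ.kernel h T x (x - t))
    ((φ.continuous_kernel_slice hp' h T).comp (Continuous.prodMk_right t))
    (B * (2 * (1 + t ^ 2)⁻¹)) (φ.norm_kernel_slice_le hB hk t)

section Slice

variable (hp' : p ≠ ⊤) {T : LpR p →L[ℂ] LpR p} {B : ℝ} (hB : 0 ≤ B)
    (hk : ∀ x y, ‖φ.kernel h T x y‖ ≤ B * ((1 + x ^ 2)⁻¹ * (1 + y ^ 2)⁻¹))

theorem slice_apply (t x : ℝ) : φ.slice hp' hB hk t x = φ.kernel h T x (x - t) := rfl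

theorem norm_slice_le (t : ℝ) : ‖φ.slice hp' hB hk t‖ ≤ B * (2 * (1 + t ^ 2)⁻¹) :=
  BoundedContinuousFunction.norm_ofNormedAddCommGroup_le _ (by positivity) _

theorem norm_slice_le_const (t : ℝ) : ‖φ.slice hp' hB hk t‖ ≤ B * 2 :=
  (φ.norm_slice_le hp' hB hk t).trans (mul_le_mul_of_nonneg_left
    (mul_le_of_le_one_right zero_le_two
      (inv_le_one_of_one_le₀ (le_add_of_nonneg_right (sq_nonneg _)))) hB)

theorem integrable_slice (t : ℝ) : Integrable (φ.slice hp' hB hk t) := by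
  refine (integrable_inv_one_add_sq.const_mul B).mono'
    (φ.slice hp' hB hk t).continuous.aestronglyMeasurable
    (Eventually.of_forall fun x => (hk x (x - t)).trans ?_)
  refine mul_le_mul_of_nonneg_left (mul_le_of_le_one_right (by positivity) ?_) hB
  exact inv_le_one_of_one_le₀ (le_add_of_nonneg_right (sq_nonneg _))

theorem norm_slice_mul_transOp_le (t : ℝ) :
    ‖(mulOp (φ.slice hp' hB hk t) * transOp t : LpR p →L[ℂ] LpR p)‖ ≤
      B * (2 * (1 + t ^ 2)⁻¹) :=
  (norm_mul_le _ _).trans ((mul_le_of_le_one_right (norm_nonneg _) (norm_transOp_le t)).trans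
    ((norm_mulOp_le _).trans (φ.norm_slice_le hp' hB hk t)))

theorem continuous_slice_mul_transOp (f : LpR p) :
    Continuous fun t => (mulOp (φ.slice hp' hB hk t) * transOp t : LpR p →L[ℂ] LpR p) f :=
  Continuous.mulOp_apply hp' (φ.norm_slice_le_const hp' hB hk)
    (fun x => (φ.continuous_kernel_slice hp' h T).comp (Continuous.prodMk_left x))
    (Continuous.transOp_apply hp' continuous_id continuous_const)

/-- The compression of `T` is the strong integral of the operators `M_K D_t`, where `K`
runs over the slices of the kernel. -/
theorem compress_eq_intOp (hp : 1 < p) (hC : 0 ≤ C) (hh : ∀ x, ‖h x‖ ≤ C * (1 + x ^ 2)⁻¹) :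
    (mulOp h * φ.convOp hp') * T * (mulOp h * φ.convOp hp') =
      intOp (fun t => mulOp (φ.slice hp' hB hk t) * transOp t) (fun t => B * (2 * (1 + t ^ 2)⁻¹))
        ((integrable_inv_one_add_sq.const_mul 2).const_mul B)
        (φ.norm_slice_mul_transOp_le hp' hB hk)
        (fun f => (φ.continuous_slice_mul_transOp hp' hB hk f).aestronglyMeasurable) := by
  ext1 f
  refine Lp.ext ?_
  have h1 := coeFn_integral_Lp (integrable_apply_of_norm_le
      ((integrable_inv_one_add_sq.const_mul 2).const_mul B)
      (φ.norm_slice_mul_transOp_le hp' hB hk)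
      (fun f => (φ.continuous_slice_mul_transOp hp' hB hk f).aestronglyMeasurable) f)
    (g := fun z => φ.kernel h T z.2 (z.2 - z.1) * f (z.2 - z.1))
    ((φ.continuous_kernel_slice hp' h T).aestronglyMeasurable.mul
      ((Lp.stronglyMeasurable f).comp_measurable
        (measurable_snd.sub measurable_fst)).aestronglyMeasurable)
    (Eventually.of_forall fun t => by
      filter_upwards [coeFn_mulOp (φ.slice hp' hB hk t) (transOp t f), coeFn_transOp t f]
        with x h1 h2
      refine h1.trans ?_
      rw [h2, slice_apply])
  exact (φ.coeFn_compress hp hp' hC hh T f).trans h1.symm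

end Slice

/-- Compressions of elements of the binest algebra belong to any strongly closed algebra
containing the generators. -/
theorem compress_mem (hp : 1 < p) (hp' : p ≠ ⊤) {S : Subalgebra ℂ (LpR p →L[ℂ] LpR p)}
    (hS : IsSOTClosed p (S : Set (LpR p →L[ℂ] LpR p)))
    (hexp : ∀ l, 0 ≤ l → mulOp (expB l) ∈ S) (htrans : ∀ s, 0 ≤ s → transOp s ∈ S)
    {T : LpR p →L[ℂ] LpR p} (hT : T ∈ fourierBinest p) {a : ℝ} (ha : 0 < a) :
    (mulOp (resB a ^ 2) * φ.convOp hp') * T * (mulOp (resB a ^ 2) * φ.convOp hp') ∈ S := by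
  have hC : 0 ≤ 1 + (a ^ 2)⁻¹ := by positivity
  have hh := norm_resB_sq_le ha
  obtain ⟨B, hB, hk⟩ := φ.exists_norm_kernel_le hC hh T
  rw [φ.compress_eq_intOp hp' hB hk hp hC hh]
  refine hS.intOp_mem _ _ _ fun t => ?_
  rcases le_or_gt 0 t with ht | ht
  · exact S.mul_mem (mulOp_mem_of_integral_eq_zero hp' hS hexp _
      (φ.integrable_slice hp' hB hk t) fun l hl =>
        φ.integral_kernel_slice_eq_zero hp hp' hT ha hl t) (htrans t ht)
  · have h0 : φ.slice hp' hB hk t = 0 := by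
      ext x
      rw [slice_apply]
      exact φ.kernel_eq_zero (resB a ^ 2) hT (by linarith)
    have h1 : (mulOp (φ.slice hp' hB hk t) : LpR p →L[ℂ] LpR p) = 0 := by
      rw [h0, ← norm_le_zero_iff, ← norm_zero (E := ℝ →ᵇ ℂ)]
      exact norm_mulOp_le _
    rw [h1, zero_mul]
    exact S.zero_mem

end Mollifier

end Compression

section Approximation

namespace Mollifier

theorem exists_approx {δ : ℝ} (hδ : 0 < δ) (hδ' : δ ≤ 1) :
    ∃ φ : Mollifier, (∫ s, φ s = 1) ∧ (∫ s, ‖φ s‖ = 1) ∧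
      ∀ s, s ∉ Set.Icc (0 : ℝ) δ → φ s = 0 := by
  let b : ContDiffBump (δ / 2) := ⟨δ / 4, δ / 2, by positivity, by linarith⟩
  have hz : ∀ s, s ∉ Set.Icc (0 : ℝ) δ → b.normed volume s = 0 := by
    intro s hs
    rw [← Function.notMem_support, b.support_normed_eq]
    intro h
    have hb : |s - δ / 2| < δ / 2 := by simpa [Real.dist_eq] using h
    rw [abs_lt] at hb
    exact hs ⟨by linarith, by linarith⟩
  refine ⟨⟨fun s => (b.normed volume s : ℂ),
    Complex.continuous_ofReal.comp b.continuous_normed, fun s hs => ?_⟩, ?_, ?_, fun s hs => ?_⟩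
  · rw [hz s fun h => hs ⟨h.1, h.2.trans hδ'⟩, Complex.ofReal_zero]
  · change ∫ s, (b.normed volume s : ℂ) = 1
    rw [integral_complex_ofReal, b.integral_normed, Complex.ofReal_one]
  · change ∫ s, ‖(b.normed volume s : ℂ)‖ = 1
    rw [← b.integral_normed (μ := volume)]
    refine integral_congr_ae (Eventually.of_forall fun s => ?_)
    simp only [Complex.norm_real, Real.norm_of_nonneg (b.nonneg_normed s)]
  · change (b.normed volume s : ℂ) = 0
    rw [hz s hs, Complex.ofReal_zero]

variable {p : ℝ≥0∞} [Fact (1 ≤ p)]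

theorem norm_convOp_sub_le (φ : Mollifier) (hp' : p ≠ ⊤) (h1 : ∫ s, φ s = 1)
    (h2 : ∫ s, ‖φ s‖ = 1) {f : LpR p} {ε : ℝ}
    (hε : ∀ s, φ s ≠ 0 → ‖transOp s f - f‖ ≤ ε) : ‖φ.convOp hp' f - f‖ ≤ ε := by
  have hi : Integrable fun s => φ s • transOp s f :=
    integrable_apply_of_norm_le φ.integrable.norm φ.norm_smul_transOp_le
      (φ.aestronglyMeasurable_smul_transOp hp') f
  have hf : f = ∫ s, φ s • f := by rw [integral_smul_const, h1, one_smul]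
  have he : φ.convOp hp' f - f = ∫ s, φ s • (transOp s f - f) := by
    nth_rewrite 2 [hf]
    rw [convOp_apply, ← integral_sub hi (φ.integrable.smul_const f)]
    simp_rw [smul_sub]
  have hb : ∀ s, ‖φ s • (transOp s f - f)‖ ≤ ‖φ s‖ * ε := fun s => by
    rw [norm_smul]
    by_cases hs : φ s = 0
    · simp [hs]
    · exact mul_le_mul_of_nonneg_left (hε s hs) (norm_nonneg _)
  rw [he]
  refine (norm_integral_le_of_norm_le (φ.integrable.norm.mul_const ε)
    (Eventually.of_forall hb)).trans_eq ?_
  rw [integral_mul_const, h2, one_mul]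

theorem exists_tendsto_convOp (hp' : p ≠ ⊤) :
    ∃ φ : ℕ → Mollifier, (∀ n, ∫ s, ‖φ n s‖ = 1) ∧
      ∀ f : LpR p, Tendsto (fun n => (φ n).convOp hp' f) atTop (𝓝 f) := by
  have hn : ∀ n : ℕ, 0 < 1 / ((n : ℝ) + 1) := fun n => Nat.one_div_pos_of_nat
  choose φ h1 h2 h3 using fun n : ℕ => exists_approx (hn n)
    (div_le_one_of_le₀ (le_add_of_nonneg_left n.cast_nonneg) (by positivity))
  refine ⟨φ, h2, fun f => ?_⟩
  rw [Metric.tendsto_atTop]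
  intro ε hε
  have hc : Continuous fun s : ℝ => transOp s f :=
    Continuous.transOp_apply hp' continuous_id continuous_const
  obtain ⟨δ, hδ, hs⟩ := Metric.continuousAt_iff.1 (hc.continuousAt (x := 0)) (ε / 2) (by positivity)
  obtain ⟨N, hN⟩ := exists_nat_one_div_lt hδ
  refine ⟨N, fun n hnN => ?_⟩
  rw [dist_eq_norm]
  refine ((φ n).norm_convOp_sub_le hp' (h1 n) (h2 n) (ε := ε / 2) fun s hsn => ?_).trans_lt
    (by linarith)
  have hmem : s ∈ Set.Icc 0 (1 / ((n : ℝ) + 1)) := by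
    by_contra h
    exact hsn (h3 n s h)
  have hd : dist s 0 < δ := by
    rw [Real.dist_eq, sub_zero, abs_of_nonneg hmem.1]
    exact hmem.2.trans_lt ((Nat.one_div_le_one_div hnN).trans_lt hN)
  have := hs hd
  rw [transOp_zero, dist_eq_norm] at this
  exact this.le

end Mollifier

variable {p : ℝ≥0∞} [Fact (1 ≤ p)]

/-- There is a contractive strong approximate identity of the form `M_h P`. -/
theorem exists_tendsto_mulOp_convOp (hp' : p ≠ ⊤) :
    ∃ (φ : ℕ → Mollifier) (a : ℕ → ℝ), (∀ n, 0 < a n) ∧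
      (∀ n (f : LpR p), ‖(mulOp (resB (a n) ^ 2) * (φ n).convOp hp' :
        LpR p →L[ℂ] LpR p) f‖ ≤ ‖f‖) ∧
      ∀ f : LpR p, Tendsto (fun n => (mulOp (resB (a n) ^ 2) * (φ n).convOp hp' :
        LpR p →L[ℂ] LpR p) f)
        atTop (𝓝 f) := by
  obtain ⟨φ, h1, h2⟩ := Mollifier.exists_tendsto_convOp (p := p) hp'
  have hm : ∀ (n : ℕ) (f : LpR p), ‖mulOp (resB (1 / ((n : ℝ) + 1)) ^ 2) f‖ ≤ ‖f‖ := fun n f =>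
    ((mulOp _).le_of_opNorm_le ((norm_mulOp_le _).trans (norm_pow_resB_le _ 2)) f).trans_eq
      (one_mul _)
  refine ⟨φ, fun n => 1 / ((n : ℝ) + 1), fun n => Nat.one_div_pos_of_nat, fun n f => ?_,
    fun f => ?_⟩
  · refine (hm n _).trans (((φ n).norm_convOp_apply_le hp' f).trans_eq ?_)
    rw [h1, one_mul]
  · have h3 : Tendsto (fun n : ℕ => mulOp (resB (1 / ((n : ℝ) + 1)) ^ 2) f) atTop (𝓝 f) := by
      have := tendsto_mulOp hp' (l := atTop) (ψ := 1) (C := 1) (fun n : ℕ =>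
        norm_pow_resB_le (1 / ((n : ℝ) + 1)) 2) (fun x => ?_) f
      · rwa [mulOp_one] at this
      · have h4 := ((continuous_resB_apply x).tendsto 0).comp
          (tendsto_one_div_add_atTop_nhds_zero_nat (𝕜 := ℝ))
        rw [resB_zero] at h4
        simpa using h4.pow 2
    rw [tendsto_iff_norm_sub_tendsto_zero] at h3 ⊢
    have h5 := tendsto_iff_norm_sub_tendsto_zero.1 (h2 f)
    have h6 := h5.add h3
    rw [add_zero] at h6
    refine squeeze_zero (fun _ => norm_nonneg _) (fun n => ?_) h6
    have he : (mulOp (resB (1 / ((n : ℝ) + 1)) ^ 2) * (φ n).convOp hp' :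
        LpR p →L[ℂ] LpR p) f - f =
        mulOp (resB (1 / ((n : ℝ) + 1)) ^ 2) ((φ n).convOp hp' f - f) +
          (mulOp (resB (1 / ((n : ℝ) + 1)) ^ 2) f - f) := by
      rw [map_sub, sub_add_sub_cancel]; rfl
    rw [he]
    exact (norm_add_le _ _).trans (add_le_add_left (hm n _) _)

theorem fourierBinest_subset_parabolicAlgebra (hp : 1 < p) (hp' : p ≠ ⊤) :
    fourierBinest p ⊆ parabolicAlgebra p := by
  rintro T hT _ ⟨hgen, hS, S, rfl⟩
  obtain ⟨φ, a, ha, hle, hX⟩ := exists_tendsto_mulOp_convOp (p := p) hp'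
  have hexp : ∀ l, 0 ≤ l → mulOp (expB l) ∈ S := fun l hl =>
    hgen (Or.inl ⟨l, hl, eq_mulOp_iff.2 rfl⟩)
  have htrans : ∀ s, 0 ≤ s → transOp s ∈ S := fun s hs =>
    hgen (Or.inr ⟨s, hs, eq_transOp_iff.2 rfl⟩)
  refine hS.mem_of_tendsto (fun n => (φ n).compress_mem hp hp' hS hexp htrans hT (ha n))
    (l := atTop) fun f => ?_
  set X : ℕ → LpR p →L[ℂ] LpR p := fun n => mulOp (resB (a n) ^ 2) * (φ n).convOp hp'
  have h1 : Tendsto (fun n => T (X n f)) atTop (𝓝 (T f)) := (T.continuous.tendsto f).comp (hX f)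
  have h2 := hX (T f)
  rw [tendsto_iff_norm_sub_tendsto_zero] at h1 h2 ⊢
  have h3 := h1.add h2
  rw [add_zero] at h3
  refine squeeze_zero (fun _ => norm_nonneg _) (fun n => ?_) h3
  have he : (X n * T * X n) f - T f = X n (T (X n f) - T f) + (X n (T f) - T f) := by
    rw [map_sub, sub_add_sub_cancel]; rfl
  rw [he]
  exact (norm_add_le _ _).trans (add_le_add_left (hle n _) _)

end Approximation

/-- For every `p ∈ (1,∞)`, the parabolic algebra equals the Fourier binest
algebra; in particular the parabolic algebra is reflexive: it equals the algebra of all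
operators leaving invariant every closed subspace invariant under the parabolic algebra. -/
theorem parabolicAlgebra_eq_fourierBinest_and_reflexive
    (p : ℝ≥0∞) [Fact (1 ≤ p)] (hp : 1 < p) (hp' : p ≠ ⊤) :
    parabolicAlgebra p = fourierBinest p ∧
    parabolicAlgebra p =
      {T : LpR p →L[ℂ] LpR p |
        ∀ K : Submodule ℂ (LpR p), IsClosed (K : Set (LpR p)) →
          (∀ S ∈ parabolicAlgebra p, ∀ f ∈ K, S f ∈ K) → ∀ f ∈ K, T f ∈ K} := by
  have h := (parabolicAlgebra_subset_fourierBinest hp hp').antisymm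
    (fourierBinest_subset_parabolicAlgebra hp hp')
  refine ⟨h, ?_⟩
  rw [h, ← coe_invAlg_binestFamily hp hp']
  exact invAlg_eq_setOf_invariant fun K hK => isClosed_of_mem_binestFamily hp hp' hK

end
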